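/- arXiv:2208.12302 — 5 statements merged into one kernel-verified Lean document; each statement's English description precedes it below -/
import Mathlib

section
/- Fix an integer d ≥ 1, s ∈ (0,1) and t_0 > 0. There exists a constant C > 0, depending only on d, s and t_0, such that for all t ≥ t_0, all ε ∈ (0,1], and all k, ξ ∈ ℝ^d: | J(ε,t,k,ξ) − ( |ξ|^{2s} t + |k|^{2s}/(2s) ) | ≤ C ε^s ( |ξ|^{2s} + |k|^{2s} ). -/
open MeasureTheory

/-- `J(ε,t,k,ξ) = ∫_0^{ε^{−2s} t} |e^{−w}(k − εξ) + εξ|^{2s} dw`, with real powers. -/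
noncomputable def Jfun (d : ℕ) (s ε t : ℝ) (k ξ : EuclideanSpace ℝ (Fin d)) : ℝ :=
  ∫ w in (0 : ℝ)..(ε ^ (-(2 * s)) * t), ‖Real.exp (-w) • (k - ε • ξ) + ε • ξ‖ ^ (2 * s)

theorem norm_add_rpow_sub_le {E : Type*} [NormedAddCommGroup E] {s : ℝ} (hs : 0 < s)
    (hs1 : s ≤ 1) (a b : E) :
    |‖a + b‖ ^ (2 * s) - ‖a‖ ^ (2 * s) - ‖b‖ ^ (2 * s)| ≤ 3 * (‖a‖ ^ s * ‖b‖ ^ s) := by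
  have hup := norm_add_le a b
  have hlow := abs_norm_sub_norm_le a (-b)
  rw [norm_neg, sub_neg_eq_add] at hlow
  have hx := norm_nonneg a
  have hy := norm_nonneg b
  have hz := norm_nonneg (a + b)
  generalize ‖a + b‖ = z at *
  generalize ‖a‖ = x at *
  generalize ‖b‖ = y at *
  have sq_rpow : ∀ u : ℝ, 0 ≤ u → u ^ (2 * s) = (u ^ 2) ^ s := fun u hu => by
    rw [Real.rpow_mul hu, Real.rpow_two]
  rw [sq_rpow z hz, sq_rpow x hx, sq_rpow y hy]
  have hxy : (2 * x * y) ^ s ≤ 2 * (x ^ s * y ^ s) := by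
    rw [mul_assoc, Real.mul_rpow (by norm_num) (by positivity), Real.mul_rpow hx hy]
    gcongr
    exact Real.rpow_le_self_of_one_le (by norm_num) hs1
  have hpos : 0 ≤ x ^ s * y ^ s := by positivity
  have hzle : (z ^ 2) ^ s ≤ (x ^ 2) ^ s + (y ^ 2) ^ s + (2 * x * y) ^ s :=
    calc (z ^ 2) ^ s ≤ (x ^ 2 + y ^ 2 + 2 * x * y) ^ s := by
          gcongr
          nlinarith
      _ ≤ (x ^ 2 + y ^ 2) ^ s + (2 * x * y) ^ s :=
          Real.rpow_add_le_add_rpow (by positivity) (by positivity) hs.le hs1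
      _ ≤ _ := by
          gcongr
          exact Real.rpow_add_le_add_rpow (by positivity) (by positivity) hs.le hs1
  have hlez : (x ^ 2 + y ^ 2) ^ s ≤ (z ^ 2) ^ s + (2 * x * y) ^ s :=
    calc (x ^ 2 + y ^ 2) ^ s ≤ (z ^ 2 + 2 * x * y) ^ s := by
          refine Real.rpow_le_rpow (by positivity) ?_ hs.le
          nlinarith [sq_le_sq' (abs_le.1 hlow).1 (abs_le.1 hlow).2,
            sq_abs (x - y), abs_nonneg (x - y)]
      _ ≤ _ := Real.rpow_add_le_add_rpow (by positivity) (by positivity) hs.le hs1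
  have hsum : (x ^ 2) ^ s + (y ^ 2) ^ s ≤ (x ^ 2 + y ^ 2) ^ s + x ^ s * y ^ s := by
    have hmin : ∀ u v : ℝ, 0 ≤ u → u ≤ v → (u ^ 2) ^ s ≤ v ^ s * u ^ s := fun u v hu huv => by
      rw [sq, Real.mul_rpow hu hu]
      gcongr
    have hX : (x ^ 2) ^ s ≤ (x ^ 2 + y ^ 2) ^ s := by gcongr; nlinarith
    have hY : (y ^ 2) ^ s ≤ (x ^ 2 + y ^ 2) ^ s := by gcongr; nlinarith
    rcases le_total x y with h | h
    · linarith [hmin x y hx h, mul_comm (x ^ s) (y ^ s)]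
    · linarith [hmin y x hy h]
  rw [abs_le]
  constructor <;> linarith

theorem abs_one_sub_rpow_sub_one_le {s x : ℝ} (hs : 0 < s) (hs1 : s ≤ 1) (hx : 0 ≤ x)
    (hx1 : x ≤ 1) : |(1 - x) ^ (2 * s) - 1| ≤ 2 * x := by
  have h0 : 0 ≤ 1 - x := by linarith
  have hle : (1 - x) ^ (2 * s) ≤ 1 :=
    Real.rpow_le_one h0 (by linarith) (by positivity)
  have hge : (1 - x) ^ 2 ≤ (1 - x) ^ (2 * s) := by
    rw [← Real.rpow_two]
    exact Real.rpow_le_rpow_of_exponent_ge_of_imp h0 (by linarith) (by linarith)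
      (fun _ h => absurd h (by positivity))
  rw [abs_le]
  constructor <;> nlinarith

theorem integral_exp_neg_mul {c : ℝ} (hc : c ≠ 0) (T : ℝ) :
    ∫ w in (0 : ℝ)..T, Real.exp (-(c * w)) = (1 - Real.exp (-(c * T))) / c := by
  have h : ∀ w ∈ Set.uIcc 0 T,
      HasDerivAt (fun w => -Real.exp (-(c * w)) / c) (Real.exp (-(c * w))) w := fun w _ => by
    exact ((((hasDerivAt_id' w).const_mul c).neg.exp.neg.div_const c)).congr_deriv
      (by simp [hc])
  rw [intervalIntegral.integral_eq_sub_of_hasDerivAt h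
    ((by fun_prop : Continuous _).intervalIntegrable _ _)]
  simp
  ring

theorem abs_integrand_sub_le {E : Type*} [NormedAddCommGroup E] [NormedSpace ℝ E] {s ε w : ℝ}
    (hs : 0 < s) (hs1 : s ≤ 1) (hε : 0 < ε) (hε1 : ε ≤ 1) (hw : 0 ≤ w) (k ξ : E) :
    |‖Real.exp (-w) • (k - ε • ξ) + ε • ξ‖ ^ (2 * s) -
        (Real.exp (-(2 * s * w)) * ‖k‖ ^ (2 * s) + ε ^ (2 * s) * ‖ξ‖ ^ (2 * s))| ≤
      6 * ε ^ s * (‖ξ‖ ^ (2 * s) + ‖k‖ ^ (2 * s)) * Real.exp (-(s * w)) := by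
  have hx0 := Real.exp_pos (-w)
  have hx1 : Real.exp (-w) ≤ 1 := Real.exp_le_one_iff.2 (by linarith)
  have hexp : ∀ c : ℝ, Real.exp (-w) ^ c = Real.exp (-(c * w)) := fun c => by
    rw [← Real.exp_mul]
    ring_nf
  have hself : Real.exp (-w) ≤ Real.exp (-(s * w)) := Real.exp_le_exp.2 (by nlinarith)
  have h1 := norm_add_rpow_sub_le hs hs1 (Real.exp (-w) • k) ((ε * (1 - Real.exp (-w))) • ξ)
  have h2 := abs_one_sub_rpow_sub_one_le hs hs1 hx0.le hx1
  have heq : Real.exp (-w) • k + (ε * (1 - Real.exp (-w))) • ξ =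
      Real.exp (-w) • (k - ε • ξ) + ε • ξ := by module
  have h0 : 0 ≤ 1 - Real.exp (-w) := by linarith
  rw [heq, norm_smul, norm_smul, Real.norm_of_nonneg hx0.le,
    Real.norm_of_nonneg (mul_nonneg hε.le h0)] at h1
  have hsplit : ∀ c : ℝ, (ε * (1 - Real.exp (-w)) * ‖ξ‖) ^ c =
      ε ^ c * (1 - Real.exp (-w)) ^ c * ‖ξ‖ ^ c := fun c => by
    rw [Real.mul_rpow (by positivity) (norm_nonneg _), Real.mul_rpow hε.le h0]
  rw [hsplit, hsplit, Real.mul_rpow hx0.le (norm_nonneg k),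
    Real.mul_rpow hx0.le (norm_nonneg k), hexp, hexp] at h1
  have hq1 : (1 - Real.exp (-w)) ^ s ≤ 1 := Real.rpow_le_one h0 (by linarith) hs.le
  have hεs : ε ^ (2 * s) ≤ ε ^ s := Real.rpow_le_rpow_of_exponent_ge hε hε1 (by linarith)
  have hsq : ∀ u : ℝ, 0 ≤ u → u ^ (2 * s) = (u ^ s) ^ 2 := fun u hu => by
    rw [mul_comm, Real.rpow_mul hu, Real.rpow_two]
  have hamgm : ‖k‖ ^ s * ‖ξ‖ ^ s ≤ ‖ξ‖ ^ (2 * s) + ‖k‖ ^ (2 * s) := by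
    rw [hsq _ (norm_nonneg k), hsq _ (norm_nonneg ξ)]
    nlinarith [sq_nonneg (‖k‖ ^ s - ‖ξ‖ ^ s), sq_nonneg (‖k‖ ^ s), sq_nonneg (‖ξ‖ ^ s)]
  have hb1 : 3 * (Real.exp (-(s * w)) * ‖k‖ ^ s * (ε ^ s * (1 - Real.exp (-w)) ^ s * ‖ξ‖ ^ s)) ≤
      3 * ε ^ s * (‖ξ‖ ^ (2 * s) + ‖k‖ ^ (2 * s)) * Real.exp (-(s * w)) :=
    calc _ = 3 * ε ^ s * ((‖k‖ ^ s * ‖ξ‖ ^ s) * (1 - Real.exp (-w)) ^ s) *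
            Real.exp (-(s * w)) := by ring
      _ ≤ 3 * ε ^ s * ((‖ξ‖ ^ (2 * s) + ‖k‖ ^ (2 * s)) * 1) * Real.exp (-(s * w)) := by
          gcongr
      _ = _ := by ring
  have hb2 : |ε ^ (2 * s) * ‖ξ‖ ^ (2 * s) * ((1 - Real.exp (-w)) ^ (2 * s) - 1)| ≤
      2 * ε ^ s * (‖ξ‖ ^ (2 * s) + ‖k‖ ^ (2 * s)) * Real.exp (-(s * w)) := by
    rw [abs_mul, abs_of_nonneg (by positivity)]
    calc _ ≤ ε ^ s * (‖ξ‖ ^ (2 * s) + ‖k‖ ^ (2 * s)) * (2 * Real.exp (-(s * w))) := by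
          gcongr
          · exact le_add_of_nonneg_right (by positivity)
          · linarith
      _ = _ := by ring
  have hpos : 0 ≤ ε ^ s * (‖ξ‖ ^ (2 * s) + ‖k‖ ^ (2 * s)) * Real.exp (-(s * w)) := by
    positivity
  rw [abs_le] at h1 hb2 ⊢
  constructor <;> linarith

/-- Fix `d ≥ 1`, `s ∈ (0,1)`, `t₀ > 0`.  There is `C > 0` depending only on `d, s, t₀`
such that for all `t ≥ t₀`, `ε ∈ (0,1]` and `k, ξ ∈ ℝ^d`:
`|J(ε,t,k,ξ) − (|ξ|^{2s} t + |k|^{2s}/(2s))| ≤ C ε^s (|ξ|^{2s} + |k|^{2s})`. -/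
theorem stmt_3 (d : ℕ) (hd : 1 ≤ d) (s t₀ : ℝ) (hs : s ∈ Set.Ioo (0 : ℝ) 1) (ht₀ : 0 < t₀) :
    ∃ C : ℝ, 0 < C ∧ ∀ t : ℝ, t₀ ≤ t → ∀ ε ∈ Set.Ioc (0 : ℝ) 1,
      ∀ k ξ : EuclideanSpace ℝ (Fin d),
        |Jfun d s ε t k ξ - (‖ξ‖ ^ (2 * s) * t + ‖k‖ ^ (2 * s) / (2 * s))| ≤
          C * ε ^ s * (‖ξ‖ ^ (2 * s) + ‖k‖ ^ (2 * s)) := by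
  obtain ⟨hs0, hs1⟩ := hs
  refine ⟨6 / s + 1 / (4 * s ^ 2 * t₀), by positivity, ?_⟩
  rintro t ht ε ⟨hε, hε1⟩ k ξ
  have ht0 : 0 < t := ht₀.trans_le ht
  set T := ε ^ (-(2 * s)) * t with hT
  have hT0 : 0 < T := by positivity
  have hεT : ε ^ (2 * s) * T = t := by
    rw [hT, ← mul_assoc, ← Real.rpow_add hε]
    simp
  set S := ‖ξ‖ ^ (2 * s) + ‖k‖ ^ (2 * s) with hS
  have hkS : ‖k‖ ^ (2 * s) ≤ S := le_add_of_nonneg_left (by positivity)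
  have hS0 : 0 ≤ S := by positivity
  have hcf : Continuous fun w : ℝ => ‖Real.exp (-w) • (k - ε • ξ) + ε • ξ‖ ^ (2 * s) :=
    (by fun_prop : Continuous fun w : ℝ => ‖Real.exp (-w) • (k - ε • ξ) + ε • ξ‖).rpow_const
      fun _ => Or.inr (by positivity)
  have hcg : Continuous fun w : ℝ =>
      Real.exp (-(2 * s * w)) * ‖k‖ ^ (2 * s) + ε ^ (2 * s) * ‖ξ‖ ^ (2 * s) := by fun_prop
  have hg : ∫ w in (0 : ℝ)..T,
      (Real.exp (-(2 * s * w)) * ‖k‖ ^ (2 * s) + ε ^ (2 * s) * ‖ξ‖ ^ (2 * s)) =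
      (1 - Real.exp (-(2 * s * T))) / (2 * s) * ‖k‖ ^ (2 * s) + ‖ξ‖ ^ (2 * s) * t := by
    rw [intervalIntegral.integral_add ((by fun_prop : Continuous _).intervalIntegrable _ _)
      (by simp), intervalIntegral.integral_mul_const, integral_exp_neg_mul (by positivity),
      intervalIntegral.integral_const, ← hεT]
    simp only [smul_eq_mul]
    ring
  have hdiff := intervalIntegral.integral_sub (hcf.intervalIntegrable (μ := volume) 0 T)
    (hcg.intervalIntegrable 0 T)
  rw [hg] at hdiff
  have hbound := intervalIntegral.norm_integral_le_of_norm_le (f := fun w =>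
      ‖Real.exp (-w) • (k - ε • ξ) + ε • ξ‖ ^ (2 * s) -
        (Real.exp (-(2 * s * w)) * ‖k‖ ^ (2 * s) + ε ^ (2 * s) * ‖ξ‖ ^ (2 * s))) hT0.le
    (Filter.Eventually.of_forall fun w hw =>
      abs_integrand_sub_le hs0 hs1.le hε hε1 hw.1.le k ξ)
    ((by fun_prop : Continuous fun w : ℝ =>
      6 * ε ^ s * (‖ξ‖ ^ (2 * s) + ‖k‖ ^ (2 * s)) * Real.exp (-(s * w))).intervalIntegrable
        (μ := volume) 0 T)
  rw [hdiff, intervalIntegral.integral_const_mul, integral_exp_neg_mul hs0.ne',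
    Real.norm_eq_abs] at hbound
  have hmain : 6 * ε ^ s * S * ((1 - Real.exp (-(s * T))) / s) ≤ 6 / s * ε ^ s * S :=
    calc _ ≤ 6 * ε ^ s * S * (1 / s) := by
          gcongr
          linarith [Real.exp_pos (-(s * T))]
      _ = _ := by ring
  have htail : Real.exp (-(2 * s * T)) / (2 * s) * ‖k‖ ^ (2 * s) ≤
      1 / (4 * s ^ 2 * t₀) * ε ^ s * S := by
    have hexp : Real.exp (-(2 * s * T)) ≤ ε ^ s / (2 * s * t₀) := by
      have hεs : ε ^ (2 * s) ≤ ε ^ s := Real.rpow_le_rpow_of_exponent_ge hε hε1 (by linarith)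
      rw [Real.exp_neg]
      calc _ ≤ (2 * s * T)⁻¹ := by
            gcongr
            linarith [Real.add_one_le_exp (2 * s * T)]
        _ = ε ^ (2 * s) / (2 * s * t) := by
            rw [← hεT]
            field_simp
        _ ≤ _ := by gcongr
    calc _ ≤ ε ^ s / (2 * s * t₀) / (2 * s) * S := by gcongr
      _ = _ := by
          field_simp
          ring
  have htail0 : 0 ≤ Real.exp (-(2 * s * T)) / (2 * s) * ‖k‖ ^ (2 * s) := by positivity
  have hJ : Jfun d s ε t k ξ =
      ∫ w in (0 : ℝ)..T, ‖Real.exp (-w) • (k - ε • ξ) + ε • ξ‖ ^ (2 * s) := rfl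
  rw [← hJ] at hbound
  rw [sub_div, sub_mul, one_div_mul_eq_div] at hbound
  rw [abs_le] at hbound ⊢
  constructor <;> linarith
end

section
/- Fix an integer d ≥ 1, s ∈ (0,1) and t_0 > 0. There exists ε_0 > 0, depending only on d, s and t_0, such that for all ε ∈ (0, ε_0], all t ≥ t_0, and all k, ξ ∈ ℝ^d: J(ε,t,k,ξ) ≥ (1/2) ( |ξ|^{2s} t + |k|^{2s}/(2s) ). -/
open MeasureTheory

/-- Subtraction lower bound for the power `2s`, with an error that is geometric in `u` and `v`. -/
lemma rpow_add_rpow_sub_le_abs_sub_rpow {s u v : ℝ} (hs0 : 0 < s) (hs1 : s < 1) (hu : 0 ≤ u)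
    (hv : 0 ≤ v) :
    u ^ (2 * s) + v ^ (2 * s) - 3 * (u ^ s * v ^ s) ≤ |u - v| ^ (2 * s) := by
  have sq_rpow : ∀ x : ℝ, 0 ≤ x → x ^ (2 * s) = (x ^ 2) ^ s := fun x hx => by
    rw [Real.rpow_mul hx, Real.rpow_two]
  have hus := Real.rpow_nonneg hu s
  have hvs := Real.rpow_nonneg hv s
  have hsub : (u ^ 2 + v ^ 2) ^ s ≤ ((u - v) ^ 2) ^ s + (2 * (u * v)) ^ s := by
    have h := Real.rpow_add_le_add_rpow (sq_nonneg (u - v))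
      (show (0 : ℝ) ≤ 2 * (u * v) by positivity) hs0.le hs1.le
    rwa [show (u - v) ^ 2 + 2 * (u * v) = u ^ 2 + v ^ 2 by ring] at h
  have htwo : (2 * (u * v)) ^ s ≤ 2 * (u ^ s * v ^ s) := by
    rw [Real.mul_rpow zero_le_two (by positivity), Real.mul_rpow hu hv]
    gcongr
    exact Real.rpow_le_self_of_one_le one_le_two hs1.le
  have hmax : (u ^ 2) ^ s + (v ^ 2) ^ s - u ^ s * v ^ s ≤ (u ^ 2 + v ^ 2) ^ s := by
    have hU : (u ^ 2) ^ s = u ^ s * u ^ s := by rw [pow_two, Real.mul_rpow hu hu]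
    have hV : (v ^ 2) ^ s = v ^ s * v ^ s := by rw [pow_two, Real.mul_rpow hv hv]
    rcases le_total u v with h | h
    · have h1 : u ^ s ≤ v ^ s := Real.rpow_le_rpow hu h hs0.le
      have h2 : (v ^ 2) ^ s ≤ (u ^ 2 + v ^ 2) ^ s :=
        Real.rpow_le_rpow (by positivity) (by nlinarith) hs0.le
      nlinarith [mul_le_mul_of_nonneg_left h1 hus]
    · have h1 : v ^ s ≤ u ^ s := Real.rpow_le_rpow hv h hs0.le
      have h2 : (u ^ 2) ^ s ≤ (u ^ 2 + v ^ 2) ^ s :=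
        Real.rpow_le_rpow (by positivity) (by nlinarith) hs0.le
      nlinarith [mul_le_mul_of_nonneg_right h1 hvs]
  rw [sq_rpow u hu, sq_rpow v hv, sq_rpow _ (abs_nonneg _), sq_abs]
  linarith

lemma exp_neg_smul_norm_rpow_lower_bound {E : Type*} [NormedAddCommGroup E] [NormedSpace ℝ E]
    {s w : ℝ} (hs0 : 0 < s) (hs1 : s < 1) (hw : 0 ≤ w) (k η : E) :
    ‖k‖ ^ (2 * s) * Real.exp (-(2 * s) * w) + ‖η‖ ^ (2 * s) * (1 - 2 * Real.exp (-w))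
        - 3 * (‖k‖ ^ s * ‖η‖ ^ s) * Real.exp (-s * w)
      ≤ ‖Real.exp (-w) • (k - η) + η‖ ^ (2 * s) := by
  set e := Real.exp (-w) with he
  have he0 : 0 < e := Real.exp_pos _
  have he1 : e ≤ 1 := Real.exp_le_one_iff.2 (by linarith)
  have hexp : ∀ c : ℝ, e ^ c = Real.exp (-c * w) := fun c => by
    rw [he, ← Real.exp_mul]; ring_nf
  have hnorm : |e * ‖k‖ - (1 - e) * ‖η‖| ≤ ‖e • (k - η) + η‖ := by
    have h := abs_norm_sub_norm_le (e • k) (-((1 - e) • η))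
    rw [norm_neg, norm_smul_of_nonneg he0.le, norm_smul_of_nonneg (by linarith)] at h
    rwa [show e • k - -((1 - e) • η) = e • (k - η) + η by
      rw [smul_sub, sub_smul, one_smul]; abel] at h
  refine le_trans ?_ (Real.rpow_le_rpow (abs_nonneg _) hnorm (by positivity))
  have hk := norm_nonneg k
  have hη := norm_nonneg η
  have h1e : 0 ≤ 1 - e := by linarith
  refine le_trans ?_ (rpow_add_rpow_sub_le_abs_sub_rpow hs0 hs1 (mul_nonneg he0.le hk)
    (mul_nonneg h1e hη))
  rw [Real.mul_rpow he0.le hk, Real.mul_rpow h1e hη, Real.mul_rpow he0.le hk,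
    Real.mul_rpow h1e hη, hexp, hexp]
  have hA : 1 - 2 * e ≤ (1 - e) ^ (2 * s) := by
    have h := Real.rpow_le_rpow_of_exponent_ge_of_imp h1e (by linarith)
      (show 2 * s ≤ 2 by linarith) (fun _ h => by linarith)
    rw [Real.rpow_two] at h
    nlinarith
  have hB : (1 - e) ^ s ≤ 1 := Real.rpow_le_one h1e (by linarith) hs0.le
  have h1 := mul_le_mul_of_nonneg_left hA (Real.rpow_nonneg hη (2 * s))
  have h2 := mul_le_mul_of_nonneg_left hB
    (show 0 ≤ (‖k‖ ^ s * ‖η‖ ^ s) * Real.exp (-s * w) by positivity)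
  nlinarith

lemma integral_exp_lower_bound {s : ℝ} (hs0 : 0 < s) (A B C T : ℝ) :
    ∫ w in (0 : ℝ)..T, (A * Real.exp (-(2 * s) * w) + B * (1 - 2 * Real.exp (-w))
        - C * Real.exp (-s * w))
      = A * (1 - Real.exp (-(2 * s) * T)) / (2 * s) + B * (T + 2 * Real.exp (-T) - 2)
        - C * (1 - Real.exp (-s * T)) / s := by
  have hexp : ∀ c w : ℝ, HasDerivAt (fun x => Real.exp (c * x)) (Real.exp (c * w) * c) w :=
    fun c w => by simpa using ((hasDerivAt_id w).const_mul c).exp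
  have hderiv : ∀ w ∈ Set.uIcc 0 T, HasDerivAt
      (fun w => A * Real.exp (-(2 * s) * w) * (-1 / (2 * s)) + B * (w + 2 * Real.exp (-1 * w))
        + C * Real.exp (-s * w) / s)
      (A * Real.exp (-(2 * s) * w) + B * (1 - 2 * Real.exp (-w)) - C * Real.exp (-s * w)) w := by
    intro w _
    have h := ((((hexp (-(2 * s)) w).const_mul A).mul_const (-1 / (2 * s))).add
      (((hasDerivAt_id w).add ((hexp (-1) w).const_mul 2)).const_mul B)).add
      (((hexp (-s) w).const_mul C).div_const s)
    refine h.congr_deriv ?_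
    rw [neg_one_mul]
    field_simp
    ring
  rw [intervalIntegral.integral_eq_sub_of_hasDerivAt hderiv
    (Continuous.intervalIntegrable (by fun_prop) _ _)]
  simp only [mul_zero, Real.exp_zero, neg_one_mul]
  field_simp
  ring

lemma integral_norm_rpow_lower_bound {E : Type*} [NormedAddCommGroup E] [NormedSpace ℝ E]
    {s T : ℝ} (hs0 : 0 < s) (hs1 : s < 1) (hT : 4 + 36 / s ≤ T) (k η : E) :
    (1 / 2) * (‖η‖ ^ (2 * s) * T + ‖k‖ ^ (2 * s) / (2 * s))
      ≤ ∫ w in (0 : ℝ)..T, ‖Real.exp (-w) • (k - η) + η‖ ^ (2 * s) := by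
  have hs36 : 0 < 36 / s := by positivity
  have hT0 : 0 ≤ T := by linarith
  have hmono := intervalIntegral.integral_mono_on (μ := volume) hT0
    (Continuous.intervalIntegrable (by fun_prop) _ _)
    (Continuous.intervalIntegrable (Continuous.rpow_const (by fun_prop)
      fun _ => Or.inr (by positivity)) _ _)
    (fun w hw => exp_neg_smul_norm_rpow_lower_bound hs0 hs1 hw.1 k η)
  refine le_trans ?_ hmono
  rw [integral_exp_lower_bound hs0]
  have sq_rpow : ∀ x : ℝ, 0 ≤ x → x ^ (2 * s) = (x ^ s) ^ 2 := fun x hx => by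
    rw [mul_comm, Real.rpow_mul hx, Real.rpow_two]
  rw [sq_rpow _ (norm_nonneg k), sq_rpow _ (norm_nonneg η)]
  set x := ‖k‖ ^ s
  set y := ‖η‖ ^ s
  have hx : 0 ≤ x := Real.rpow_nonneg (norm_nonneg _) _
  have hy : 0 ≤ y := Real.rpow_nonneg (norm_nonneg _) _
  have hsT : 36 ≤ s * T := by
    have h := mul_le_mul_of_nonneg_left hT hs0.le
    rw [mul_add, mul_div_cancel₀ _ hs0.ne'] at h
    linarith
  have hE : Real.exp (-(2 * s) * T) ≤ 1 / 4 := by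
    rw [neg_mul, Real.exp_neg, ← one_div]
    exact one_div_le_one_div_of_le (by norm_num)
      (by linarith [Real.add_one_le_exp (2 * s * T)])
  have h1 : x ^ 2 * (3 / 4) / (2 * s) ≤ x ^ 2 * (1 - Real.exp (-(2 * s) * T)) / (2 * s) := by
    gcongr
    linarith
  have h2 : y ^ 2 * (T - 2) ≤ y ^ 2 * (T + 2 * Real.exp (-T) - 2) := by
    gcongr
    linarith [Real.exp_pos (-T)]
  have h3 : 3 * (x * y) * (1 - Real.exp (-s * T)) / s ≤ (x ^ 2 / 8 + 18 * y ^ 2) / s := by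
    gcongr
    have := mul_nonneg (mul_nonneg hx hy) (Real.exp_pos (-s * T)).le
    nlinarith [sq_nonneg (x - 12 * y)]
  have h4 : y ^ 2 * (2 + 18 / s) ≤ y ^ 2 * (T / 2) := by
    gcongr
    rw [show 18 / s = 36 / s / 2 by ring]
    linarith
  have h5 : (x ^ 2 / 8 + 18 * y ^ 2) / s = x ^ 2 / (2 * s) / 4 + y ^ 2 * (18 / s) := by
    field_simp
    ring
  have h6 : x ^ 2 * (3 / 4) / (2 * s) = x ^ 2 / (2 * s) * (3 / 4) := by ring
  nlinarith

/-- Fix `d ≥ 1`, `s ∈ (0,1)`, `t₀ > 0`.  There is `ε₀ > 0` depending only on `d, s, t₀`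
such that for all `ε ∈ (0, ε₀]`, `t ≥ t₀` and `k, ξ ∈ ℝ^d`:
`J(ε,t,k,ξ) ≥ (1/2)(|ξ|^{2s} t + |k|^{2s}/(2s))`. -/
theorem stmt_5 (d : ℕ) (hd : 1 ≤ d) (s t₀ : ℝ) (hs : s ∈ Set.Ioo (0 : ℝ) 1) (ht₀ : 0 < t₀) :
    ∃ ε₀ : ℝ, 0 < ε₀ ∧ ∀ ε ∈ Set.Ioc (0 : ℝ) ε₀, ∀ t : ℝ, t₀ ≤ t →
      ∀ k ξ : EuclideanSpace ℝ (Fin d),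
        (1 / 2) * (‖ξ‖ ^ (2 * s) * t + ‖k‖ ^ (2 * s) / (2 * s)) ≤ Jfun d s ε t k ξ := by
  obtain ⟨hs0, hs1⟩ := hs
  have hM : 0 < 4 + 36 / s := by positivity
  refine ⟨(t₀ / (4 + 36 / s)) ^ (1 / (2 * s)), by positivity, ?_⟩
  rintro ε ⟨hε, hεle⟩ t ht k ξ
  have hT : 4 + 36 / s ≤ ε ^ (-(2 * s)) * t := by
    have hpow : ε ^ (2 * s) ≤ t₀ / (4 + 36 / s) := by
      have h := Real.rpow_le_rpow hε.le hεle (show 0 ≤ 2 * s by positivity)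
      rwa [← Real.rpow_mul (by positivity), one_div_mul_cancel (by positivity),
        Real.rpow_one] at h
    rw [Real.rpow_neg hε.le, inv_mul_eq_div, le_div_iff₀ (by positivity), mul_comm]
    exact ((le_div_iff₀ hM).1 hpow).trans ht
  have hscale : ‖ε • ξ‖ ^ (2 * s) * (ε ^ (-(2 * s)) * t) = ‖ξ‖ ^ (2 * s) * t := by
    rw [norm_smul_of_nonneg hε.le, Real.mul_rpow hε.le (norm_nonneg _), Real.rpow_neg hε.le]
    field_simp
  rw [← hscale]
  exact integral_norm_rpow_lower_bound hs0 hs1 hT k (ε • ξ)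
end

section
/- Fix an integer d ≥ 1, s ∈ (0,1) and t_0 > 0. There exist ε_0 > 0 and C > 0, depending only on d, s and t_0, such that for all ε ∈ (0, ε_0], all t ≥ t_0, and all k, ξ ∈ ℝ^d: | e^{−J(ε,t,k,ξ)} − e^{−(|ξ|^{2s} t + |k|^{2s}/(2s))} | ≤ C ε^s ( |ξ|^{2s} + |k|^{2s} ) e^{−(1/2)(|ξ|^{2s} t + |k|^{2s}/(2s))}. -/
open MeasureTheory

theorem Real.abs_rpow_sub_rpow_le_abs_sub_rpow {s x y : ℝ} (hs₀ : 0 ≤ s) (hs₁ : s ≤ 1)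
    (hx : 0 ≤ x) (hy : 0 ≤ y) : |x ^ s - y ^ s| ≤ |x - y| ^ s := by
  wlog hxy : y ≤ x generalizing x y
  · rw [abs_sub_comm, abs_sub_comm x]
    exact this hy hx (le_of_not_ge hxy)
  have h := Real.rpow_add_le_add_rpow (sub_nonneg.2 hxy) hy hs₀ hs₁
  rw [sub_add_cancel] at h
  rw [abs_of_nonneg (sub_nonneg.2 (Real.rpow_le_rpow hy hxy hs₀)),
    abs_of_nonneg (sub_nonneg.2 hxy)]
  linarith

section Norm

variable {E : Type*} [SeminormedAddCommGroup E] {s : ℝ}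

theorem norm_rpow_two_mul (v : E) (s : ℝ) : ‖v‖ ^ (2 * s) = (‖v‖ ^ s) ^ 2 := by
  rw [mul_comm, Real.rpow_mul (norm_nonneg v), Real.rpow_two]

theorem norm_add_rpow_le (hs₀ : 0 ≤ s) (hs₁ : s ≤ 1) (a b : E) :
    ‖a + b‖ ^ s ≤ ‖a‖ ^ s + ‖b‖ ^ s :=
  (Real.rpow_le_rpow (norm_nonneg _) (norm_add_le a b) hs₀).trans
    (Real.rpow_add_le_add_rpow (norm_nonneg a) (norm_nonneg b) hs₀ hs₁)

theorem abs_norm_rpow_sub_norm_rpow_le_norm_add_rpow (hs₀ : 0 ≤ s) (hs₁ : s ≤ 1) (a b : E) :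
    |‖a‖ ^ s - ‖b‖ ^ s| ≤ ‖a + b‖ ^ s := by
  refine (Real.abs_rpow_sub_rpow_le_abs_sub_rpow hs₀ hs₁ (norm_nonneg a) (norm_nonneg b)).trans
    (Real.rpow_le_rpow (abs_nonneg _) ?_ hs₀)
  simpa using abs_norm_sub_norm_le a (-b)

theorem abs_norm_add_rpow_two_mul_sub_le (hs₀ : 0 ≤ s) (hs₁ : s ≤ 1) (a b : E) :
    |‖a + b‖ ^ (2 * s) - ((‖a‖ ^ s) ^ 2 + (‖b‖ ^ s) ^ 2)| ≤ 2 * (‖a‖ ^ s * ‖b‖ ^ s) := by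
  rw [norm_rpow_two_mul]
  have hupper := pow_le_pow_left₀ (Real.rpow_nonneg (norm_nonneg _) s)
    (norm_add_rpow_le hs₀ hs₁ a b) 2
  have hlower := pow_le_pow_left₀ (abs_nonneg _)
    (abs_norm_rpow_sub_norm_rpow_le_norm_add_rpow hs₀ hs₁ a b) 2
  rw [sq_abs] at hlower
  rw [abs_le]
  constructor <;> linarith

end Norm

theorem abs_integral_norm_exp_smul_add_rpow_sub_le {E : Type*} [NormedAddCommGroup E]
    [NormedSpace ℝ E] {s T : ℝ} (hs₀ : 0 < s) (hs₁ : s ≤ 1) (hT : 0 ≤ T) (u v : E) :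
    |(∫ w in (0 : ℝ)..T, ‖Real.exp (-w) • u + v‖ ^ (2 * s)) -
        ((‖u‖ ^ s) ^ 2 * ((1 - Real.exp (-(2 * s * T))) / (2 * s)) + (‖v‖ ^ s) ^ 2 * T)| ≤
      2 * (‖u‖ ^ s * ‖v‖ ^ s) / s := by
  have hnorm (w : ℝ) : ‖Real.exp (-w) • u‖ ^ s = Real.exp (-(s * w)) * ‖u‖ ^ s := by
    rw [norm_smul, Real.norm_eq_abs, Real.abs_exp,
      Real.mul_rpow (Real.exp_pos _).le (norm_nonneg u), ← Real.exp_mul]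
    ring_nf
  have hsq (w : ℝ) : (‖Real.exp (-w) • u‖ ^ s) ^ 2 =
      (‖u‖ ^ s) ^ 2 * Real.exp (-(2 * s * w)) := by
    rw [hnorm, mul_pow, ← Real.exp_nat_mul, mul_comm]
    push_cast
    ring_nf
  have hcont : Continuous fun w : ℝ => ‖Real.exp (-w) • u + v‖ ^ (2 * s) :=
    Continuous.rpow_const (by fun_prop) fun _ => Or.inr (by positivity)
  have hmain : Continuous fun w : ℝ =>
      (‖u‖ ^ s) ^ 2 * Real.exp (-(2 * s * w)) + (‖v‖ ^ s) ^ 2 := by fun_prop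
  have hbound : ∀ w ∈ Set.Ioc 0 T,
      ‖‖Real.exp (-w) • u + v‖ ^ (2 * s) -
        ((‖u‖ ^ s) ^ 2 * Real.exp (-(2 * s * w)) + (‖v‖ ^ s) ^ 2)‖ ≤
      2 * (‖u‖ ^ s * ‖v‖ ^ s) * Real.exp (-(s * w)) := by
    intro w _
    have h := abs_norm_add_rpow_two_mul_sub_le hs₀.le hs₁ (Real.exp (-w) • u) v
    rw [hsq, hnorm] at h
    rw [Real.norm_eq_abs]
    linarith
  have h := intervalIntegral.norm_integral_le_of_norm_le (μ := volume) hT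
    (Filter.Eventually.of_forall hbound)
    ((by fun_prop : Continuous fun w : ℝ =>
      2 * (‖u‖ ^ s * ‖v‖ ^ s) * Real.exp (-(s * w))).intervalIntegrable 0 T)
  rw [intervalIntegral.integral_sub (hcont.intervalIntegrable 0 T)
      (hmain.intervalIntegrable 0 T),
    intervalIntegral.integral_add ((by fun_prop : Continuous fun w : ℝ =>
      (‖u‖ ^ s) ^ 2 * Real.exp (-(2 * s * w))).intervalIntegrable 0 T)
      (continuous_const.intervalIntegrable 0 T),
    intervalIntegral.integral_const_mul, intervalIntegral.integral_const_mul,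
    integral_exp_neg_mul (by positivity), integral_exp_neg_mul hs₀.ne',
    intervalIntegral.integral_const, sub_zero, smul_eq_mul, mul_comm T, Real.norm_eq_abs] at h
  refine h.trans ?_
  rw [← mul_div_assoc]
  refine div_le_div_of_nonneg_right (mul_le_of_le_one_right (by positivity) ?_) hs₀.le
  linarith [Real.exp_pos (-(s * T))]

theorem abs_Jfun_sub_le {d : ℕ} {s t₀ ε t : ℝ} (hs₀ : 0 < s) (hs₁ : s ≤ 1) (ht₀ : 0 < t₀)
    (hε₀ : 0 < ε) (hε₁ : ε ≤ 1) (ht : t₀ ≤ t) (k ξ : EuclideanSpace ℝ (Fin d)) :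
    |Jfun d s ε t k ξ - (‖ξ‖ ^ (2 * s) * t + ‖k‖ ^ (2 * s) / (2 * s))| ≤
      (5 / s + 1 / (2 * s ^ 2 * t₀)) * ε ^ s * (‖ξ‖ ^ (2 * s) + ‖k‖ ^ (2 * s)) := by
  have hδ₀ : 0 < ε ^ s := Real.rpow_pos_of_pos hε₀ s
  have hδ₁ : ε ^ s ≤ 1 := Real.rpow_le_one hε₀.le hε₁ hs₀.le
  have hpow : ε ^ (-(2 * s)) = ((ε ^ s) ^ 2)⁻¹ := by
    rw [Real.rpow_neg hε₀.le, mul_comm, Real.rpow_mul hε₀.le, Real.rpow_two]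
  have hT₀ : 0 < ε ^ (-(2 * s)) * t := by
    have := ht₀.trans_le ht
    positivity
  have hη : ‖ε • ξ‖ ^ s = ε ^ s * ‖ξ‖ ^ s := by
    rw [norm_smul, Real.norm_of_nonneg hε₀.le, Real.mul_rpow hε₀.le (norm_nonneg ξ)]
  have hJ := abs_integral_norm_exp_smul_add_rpow_sub_le hs₀ hs₁ hT₀.le (k - ε • ξ) (ε • ξ)
  have hU := norm_add_rpow_le hs₀.le hs₁ k (-(ε • ξ))
  have hU2 := abs_norm_add_rpow_two_mul_sub_le hs₀.le hs₁ k (-(ε • ξ))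
  rw [← sub_eq_add_neg, norm_neg, hη] at hU hU2
  rw [norm_rpow_two_mul] at hU2
  rw [hη] at hJ
  change |Jfun d s ε t k ξ - _| ≤ _ at hJ
  have hHT : (ε ^ s * ‖ξ‖ ^ s) ^ 2 * (ε ^ (-(2 * s)) * t) = (‖ξ‖ ^ s) ^ 2 * t := by
    rw [hpow]
    field_simp
  have hexp : Real.exp (-(2 * s * (ε ^ (-(2 * s)) * t))) ≤ ε ^ s / (2 * s * t₀) := by
    calc Real.exp (-(2 * s * (ε ^ (-(2 * s)) * t)))
        ≤ (2 * s * (ε ^ (-(2 * s)) * t))⁻¹ := by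
          rw [Real.exp_neg]
          refine inv_anti₀ (by positivity) ?_
          linarith [Real.add_one_le_exp (2 * s * (ε ^ (-(2 * s)) * t))]
      _ = (ε ^ s) ^ 2 / (2 * s * t) := by
          rw [hpow]
          field_simp
      _ ≤ ε ^ s / (2 * s * t₀) := by
          have : (ε ^ s) ^ 2 ≤ ε ^ s := by nlinarith
          gcongr
  rw [hHT] at hJ
  rw [norm_rpow_two_mul ξ, norm_rpow_two_mul k]
  have hX₀ : 0 ≤ ‖ξ‖ ^ s := Real.rpow_nonneg (norm_nonneg _) _
  have hK₀ : 0 ≤ ‖k‖ ^ s := Real.rpow_nonneg (norm_nonneg _) _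
  have hU₀ : 0 ≤ ‖k - ε • ξ‖ ^ s := Real.rpow_nonneg (norm_nonneg _) _
  have hq₀ := (Real.exp_pos (-(2 * s * (ε ^ (-(2 * s)) * t)))).le
  generalize Real.exp (-(2 * s * (ε ^ (-(2 * s)) * t))) = q at *
  generalize Jfun d s ε t k ξ = J at *
  generalize ‖k - ε • ξ‖ ^ s = U at *
  generalize ‖k‖ ^ s = K at *
  generalize ‖ξ‖ ^ s = X at *
  generalize ε ^ s = δ at *
  have hδX : δ * X ≤ X := mul_le_of_le_one_left hX₀ hδ₁
  have hUKX : U ≤ K + X := by linarith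
  have hUsq : U ^ 2 ≤ 2 * (X ^ 2 + K ^ 2) := by nlinarith [sq_nonneg (K - X)]
  have hcross : U * (δ * X) ≤ δ * (2 * (X ^ 2 + K ^ 2)) := by
    have : U * X ≤ 2 * (X ^ 2 + K ^ 2) := by nlinarith [sq_nonneg (K - X)]
    nlinarith
  have hsq : |U ^ 2 - K ^ 2| ≤ 2 * δ * (X ^ 2 + K ^ 2) := by
    have h₁ : 2 * (K * (δ * X)) + (δ * X) ^ 2 ≤ 2 * δ * (X ^ 2 + K ^ 2) := by
      have : δ * X * (δ * X) ≤ δ * X * X := by gcongr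
      nlinarith [mul_nonneg hδ₀.le (sq_nonneg (K - X)), mul_nonneg hδ₀.le (sq_nonneg K)]
    rw [abs_le] at hU2 ⊢
    constructor <;> nlinarith [sq_nonneg (δ * X)]
  have htail : U ^ 2 * q ≤ 2 * (X ^ 2 + K ^ 2) * (δ / (2 * s * t₀)) := by gcongr
  have hsplit : J - (X ^ 2 * t + K ^ 2 / (2 * s)) =
      (J - (U ^ 2 * ((1 - q) / (2 * s)) + X ^ 2 * t)) + (U ^ 2 - K ^ 2) / (2 * s)
        - U ^ 2 * q / (2 * s) := by
    field_simp
    ring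
  rw [hsplit]
  calc _ ≤ |J - (U ^ 2 * ((1 - q) / (2 * s)) + X ^ 2 * t)| + |(U ^ 2 - K ^ 2) / (2 * s)|
          + |U ^ 2 * q / (2 * s)| :=
        (abs_sub _ _).trans (by gcongr; exact abs_add_le _ _)
    _ ≤ 2 * (δ * (2 * (X ^ 2 + K ^ 2))) / s + 2 * δ * (X ^ 2 + K ^ 2) / (2 * s)
          + 2 * (X ^ 2 + K ^ 2) * (δ / (2 * s * t₀)) / (2 * s) := by
        rw [abs_div (U ^ 2 - K ^ 2), abs_of_pos (by positivity : 0 < 2 * s),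
          abs_of_nonneg (by positivity : 0 ≤ U ^ 2 * q / (2 * s))]
        refine add_le_add (add_le_add (hJ.trans ?_) ?_) ?_ <;> gcongr
    _ = _ := by
        field_simp
        ring

theorem abs_exp_neg_sub_exp_neg_le {x y D : ℝ} (hxy : |x - y| ≤ D) (hD : D ≤ y / 2) :
    |Real.exp (-x) - Real.exp (-y)| ≤ D * Real.exp (-(1 / 2) * y) := by
  have hD₀ : 0 ≤ D := (abs_nonneg _).trans hxy
  obtain ⟨h₁, h₂⟩ := abs_le.1 hxy
  have key {a b : ℝ} (hab : a ≤ b) (hD' : b - a ≤ D) (ha : y / 2 ≤ a) :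
      |Real.exp (-a) - Real.exp (-b)| ≤ D * Real.exp (-(1 / 2) * y) := by
    rw [abs_of_nonneg (sub_nonneg.2 (Real.exp_le_exp.2 (neg_le_neg hab)))]
    have hb : Real.exp (-b) = Real.exp (-a) * Real.exp (a - b) := by
      rw [← Real.exp_add]
      ring_nf
    calc Real.exp (-a) - Real.exp (-b) = (1 - Real.exp (a - b)) * Real.exp (-a) := by
          rw [hb]
          ring
      _ ≤ D * Real.exp (-(1 / 2) * y) := by
          gcongr
          · linarith [Real.add_one_le_exp (a - b)]
          · linarith
  rcases le_total x y with h | h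
  · exact key h (by linarith) (by linarith)
  · rw [abs_sub_comm]
    exact key h (by linarith) (by linarith)

/-- Fix `d ≥ 1`, `s ∈ (0,1)`, `t₀ > 0`.  There are `ε₀ > 0` and `C > 0` depending only on
`d, s, t₀` such that for all `ε ∈ (0, ε₀]`, `t ≥ t₀`, and `k, ξ ∈ ℝ^d`:
`|e^{−J(ε,t,k,ξ)} − e^{−(|ξ|^{2s} t + |k|^{2s}/(2s))}|
   ≤ C ε^s (|ξ|^{2s} + |k|^{2s}) e^{−(1/2)(|ξ|^{2s} t + |k|^{2s}/(2s))}`. -/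
theorem stmt_6 (d : ℕ) (hd : 1 ≤ d) (s t₀ : ℝ) (hs : s ∈ Set.Ioo (0 : ℝ) 1) (ht₀ : 0 < t₀) :
    ∃ ε₀ : ℝ, 0 < ε₀ ∧ ∃ C : ℝ, 0 < C ∧ ∀ ε ∈ Set.Ioc (0 : ℝ) ε₀, ∀ t : ℝ, t₀ ≤ t →
      ∀ k ξ : EuclideanSpace ℝ (Fin d),
        |Real.exp (-Jfun d s ε t k ξ) -
            Real.exp (-(‖ξ‖ ^ (2 * s) * t + ‖k‖ ^ (2 * s) / (2 * s)))| ≤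
          C * ε ^ s * (‖ξ‖ ^ (2 * s) + ‖k‖ ^ (2 * s)) *
            Real.exp (-(1 / 2) * (‖ξ‖ ^ (2 * s) * t + ‖k‖ ^ (2 * s) / (2 * s))) := by
  obtain ⟨hs₀, hs₁⟩ := hs
  set C := 5 / s + 1 / (2 * s ^ 2 * t₀) with hC
  set A := 1 / t₀ + 2 * s with hA
  have hC₀ : 0 < C := by positivity
  have hA₀ : 0 < A := by positivity
  refine ⟨min 1 ((1 / (2 * C * A)) ^ (1 / s)), by positivity, C, hC₀, ?_⟩
  rintro ε ⟨hε₀, hε⟩ t ht k ξ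
  have ht' : 0 < t := ht₀.trans_le ht
  refine abs_exp_neg_sub_exp_neg_le (abs_Jfun_sub_le hs₀ hs₁.le ht₀ hε₀
    (hε.trans (min_le_left _ _)) ht k ξ) ?_
  have hδ : ε ^ s ≤ 1 / (2 * C * A) := by
    refine (Real.rpow_le_rpow hε₀.le (hε.trans (min_le_right _ _)) hs₀.le).trans_eq ?_
    rw [← Real.rpow_mul (by positivity), one_div_mul_cancel hs₀.ne', Real.rpow_one]
  have hX : 0 ≤ ‖ξ‖ ^ (2 * s) := by positivity
  have hK : 0 ≤ ‖k‖ ^ (2 * s) := by positivity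
  have hM : ‖ξ‖ ^ (2 * s) + ‖k‖ ^ (2 * s) ≤
      A * (‖ξ‖ ^ (2 * s) * t + ‖k‖ ^ (2 * s) / (2 * s)) := by
    have h₁ : ‖ξ‖ ^ (2 * s) ≤ 1 / t₀ * (‖ξ‖ ^ (2 * s) * t) := by
      rw [one_div, ← div_eq_inv_mul, le_div_iff₀ ht₀]
      gcongr
    have h₂ : ‖k‖ ^ (2 * s) = 2 * s * (‖k‖ ^ (2 * s) / (2 * s)) := by field_simp
    have h₃ : 0 ≤ 2 * s * (‖ξ‖ ^ (2 * s) * t) := by positivity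
    have h₄ : 0 ≤ 1 / t₀ * (‖k‖ ^ (2 * s) / (2 * s)) := by positivity
    rw [hA]
    linarith
  calc C * ε ^ s * (‖ξ‖ ^ (2 * s) + ‖k‖ ^ (2 * s))
      ≤ C * (1 / (2 * C * A)) * (A * (‖ξ‖ ^ (2 * s) * t + ‖k‖ ^ (2 * s) / (2 * s))) := by
        gcongr
    _ = (‖ξ‖ ^ (2 * s) * t + ‖k‖ ^ (2 * s) / (2 * s)) / 2 := by field_simp
end

section
/- Fix an integer d ≥ 1, s ∈ (0,1), and a real number p with −2s < p < d/2 + 2s. There exists a constant C > 0, depending only on d, s and p, such that for every Schwartz function ḡ : ℝ^d → ℝ the following holds: for every v ∈ ℝ^d the principal value L(v) = lim_{δ→0⁺} ∫_{|v−w|>δ} (⟨w⟩^p − ⟨v⟩^p) ḡ(w) / |v−w|^{d+2s} dw exists, and ‖L‖_{L²(ℝ^d)} ≤ C ( ‖⟨·⟩^p ḡ‖_{L²(ℝ^d)} + ‖⟨·⟩^{p−1} |∇ḡ|‖_{L²(ℝ^d)} ). -/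
open MeasureTheory

/-- The Japanese bracket `⟨v⟩ = (1 + |v|²)^{1/2}`. -/
noncomputable def jap {d : ℕ} (v : EuclideanSpace ℝ (Fin d)) : ℝ :=
  Real.sqrt (1 + ‖v‖ ^ 2)

section Bracket

variable {d : ℕ} (v h : EuclideanSpace ℝ (Fin d))

lemma one_le_jap : 1 ≤ jap v := by
  rw [jap, Real.one_le_sqrt]
  nlinarith [sq_nonneg ‖v‖]

lemma jap_pos : 0 < jap v := one_pos.trans_le (one_le_jap v)

lemma jap_sq : jap v ^ 2 = 1 + ‖v‖ ^ 2 := Real.sq_sqrt (by positivity)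

lemma norm_le_jap : ‖v‖ ≤ jap v :=
  Real.le_sqrt_of_sq_le (by linarith)

lemma jap_le_one_add_norm : jap v ≤ 1 + ‖v‖ := by
  rw [jap, Real.sqrt_le_left (by positivity)]
  nlinarith [norm_nonneg v]

lemma continuous_jap : Continuous (jap (d := d)) := by
  unfold jap
  fun_prop

lemma continuous_jap_rpow (q : ℝ) : Continuous fun v : EuclideanSpace ℝ (Fin d) => jap v ^ q :=
  continuous_jap.rpow_const fun v => Or.inl (jap_pos v).ne'

/-- The Japanese bracket is 1-Lipschitz. -/
lemma jap_add_le : jap (v + h) ≤ jap v + ‖h‖ := by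
  have hv := norm_le_jap v
  have := norm_add_le v h
  rw [jap, Real.sqrt_le_left (add_nonneg (jap_pos v).le (norm_nonneg h))]
  nlinarith [jap_sq v, norm_nonneg h, norm_nonneg v, norm_nonneg (v + h)]

lemma jap_le_add_norm : jap v ≤ jap (v + h) + ‖h‖ := by
  simpa using jap_add_le (v + h) (-h)

lemma rpow_le_of_comparable {x y : ℝ} (hx : 0 < x) (hy : 0 < y) (hxy : x ≤ 2 * y)
    (hyx : y ≤ 2 * x) (q : ℝ) : x ^ q ≤ 2 ^ |q| * y ^ q := by
  rcases le_total 0 q with hq | hq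
  · rw [abs_of_nonneg hq, ← Real.mul_rpow (by norm_num) hy.le]
    exact Real.rpow_le_rpow hx.le hxy hq
  · have : x ^ q ≤ (2⁻¹ * y) ^ q :=
      Real.rpow_le_rpow_of_nonpos (by positivity) (by linarith) hq
    rwa [Real.mul_rpow (by norm_num) hy.le, Real.inv_rpow (by norm_num), ← Real.rpow_neg
      (by norm_num), ← abs_of_nonpos hq] at this

lemma jap_rpow_le_of_norm_le_one (hh : ‖h‖ ≤ 1) (q : ℝ) :
    jap v ^ q ≤ 2 ^ |q| * jap (v + h) ^ q := by
  have := jap_add_le v h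
  have := jap_le_add_norm v h
  have := one_le_jap v
  have := one_le_jap (v + h)
  exact rpow_le_of_comparable (jap_pos v) (jap_pos _) (by linarith) (by linarith) q

lemma jap_add_rpow_le_of_norm_le_one (hh : ‖h‖ ≤ 1) (q : ℝ) :
    jap (v + h) ^ q ≤ 2 ^ |q| * jap v ^ q := by
  simpa using jap_rpow_le_of_norm_le_one (v + h) (-h) (by simpa using hh) q

/-- The differential of `⟨·⟩ ^ p` at `v` in direction `h`. -/
noncomputable def japDeriv (p : ℝ) : ℝ := p * jap v ^ (p - 2) * inner ℝ v h

lemma japDeriv_neg (p : ℝ) : japDeriv v (-h) p = -japDeriv v h p := by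
  simp [japDeriv]

lemma continuous_japDeriv (p : ℝ) : Continuous fun h => japDeriv v h p := by
  unfold japDeriv
  fun_prop

lemma abs_japDeriv_le (p : ℝ) : |japDeriv v h p| ≤ |p| * jap v ^ (p - 1) * ‖h‖ := by
  have h1 : jap v ^ (p - 1) = jap v ^ (p - 2) * jap v := by
    rw [← Real.rpow_add_one (jap_pos v).ne']
    ring_nf
  have h2 : |inner ℝ v h| ≤ jap v * ‖h‖ :=
    (abs_real_inner_le_norm v h).trans (by gcongr; exact norm_le_jap v)
  have := Real.rpow_pos_of_pos (jap_pos v) (p - 2)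
  rw [japDeriv, abs_mul, abs_mul, abs_of_pos this, h1]
  calc |p| * jap v ^ (p - 2) * |inner ℝ v h|
      ≤ |p| * jap v ^ (p - 2) * (jap v * ‖h‖) := by gcongr
    _ = _ := by ring

lemma hasDerivAt_jap_rpow (q t : ℝ) :
    HasDerivAt (fun t : ℝ => jap (v + t • h) ^ q) (japDeriv (v + t • h) h q) t := by
  have h0 : HasDerivAt (fun t : ℝ => v + t • h) h t := by
    simpa using ((hasDerivAt_id t).smul_const h).const_add v
  have h1 : HasDerivAt (fun t : ℝ => 1 + ‖v + t • h‖ ^ 2) (2 * inner ℝ (v + t • h) h) t :=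
    h0.norm_sq.const_add 1
  have h2 := h1.rpow_const (p := q / 2) (Or.inl (by positivity))
  have key : ∀ (u : EuclideanSpace ℝ (Fin d)) (r : ℝ),
      (1 + ‖u‖ ^ 2) ^ (r / 2) = jap u ^ r := fun u r => by
    rw [← jap_sq, ← Real.rpow_natCast, ← Real.rpow_mul (jap_pos u).le]
    congr 1
    push_cast
    ring
  simp only [key, show q / 2 - 1 = (q - 2) / 2 by ring] at h2
  convert h2 using 1
  rw [japDeriv]
  ring

lemma hasDerivAt_japDeriv (p t : ℝ) :
    HasDerivAt (fun t : ℝ => japDeriv (v + t • h) h p)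
      (p * (japDeriv (v + t • h) h (p - 2) * inner ℝ (v + t • h) h +
        jap (v + t • h) ^ (p - 2) * ‖h‖ ^ 2)) t := by
  have h0 : HasDerivAt (fun t : ℝ => inner ℝ (v + t • h) h) (‖h‖ ^ 2) t := by
    have : HasDerivAt (fun t : ℝ => v + t • h) h t := by
      simpa using ((hasDerivAt_id t).smul_const h).const_add v
    simpa using this.inner ℝ (hasDerivAt_const t h)
  have := ((hasDerivAt_jap_rpow v h (p - 2) t).mul h0).const_mul p
  simpa only [japDeriv, Pi.mul_apply, mul_assoc] using this

/-- Second-order Taylor estimate for `⟨·⟩ ^ p` on unit balls. -/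
lemma abs_jap_rpow_sub_sub_le (p : ℝ) (hh : ‖h‖ ≤ 1) :
    |jap (v + h) ^ p - jap v ^ p - japDeriv v h p| ≤
      |p| * (|p - 2| + 1) * 2 ^ |p - 2| * jap v ^ p * ‖h‖ ^ 2 := by
  set M := |p| * (|p - 2| + 1) * 2 ^ |p - 2| * jap v ^ p * ‖h‖ ^ 2 with hM
  have hM0 : 0 ≤ M := by
    have := Real.rpow_pos_of_pos (jap_pos v) p
    positivity
  have second : ∀ t ∈ Set.Icc (0 : ℝ) 1,
      ‖p * (japDeriv (v + t • h) h (p - 2) * inner ℝ (v + t • h) h +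
        jap (v + t • h) ^ (p - 2) * ‖h‖ ^ 2)‖ ≤ M := by
    intro t ht
    set u := v + t • h with hu
    have hth : ‖t • h‖ ≤ 1 := by
      rw [norm_smul, Real.norm_of_nonneg ht.1]
      exact mul_le_one₀ ht.2 (norm_nonneg h) hh
    have hpos := Real.rpow_pos_of_pos (jap_pos u) (p - 2)
    have hj : jap u ^ (p - 2) ≤ 2 ^ |p - 2| * jap v ^ p :=
      (jap_add_rpow_le_of_norm_le_one v (t • h) hth (p - 2)).trans (by
        gcongr
        · exact one_le_jap v
        · linarith)
    have e1 : jap u ^ (p - 2 - 1) * jap u = jap u ^ (p - 2) := by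
      rw [← Real.rpow_add_one (jap_pos u).ne']
      ring_nf
    have i1 : |inner ℝ u h| ≤ jap u * ‖h‖ :=
      (abs_real_inner_le_norm u h).trans (by gcongr; exact norm_le_jap u)
    have i2 := abs_japDeriv_le u h (p - 2)
    have hpos' := Real.rpow_pos_of_pos (jap_pos u) (p - 2 - 1)
    rw [Real.norm_eq_abs, abs_mul]
    calc |p| * |japDeriv u h (p - 2) * inner ℝ u h + jap u ^ (p - 2) * ‖h‖ ^ 2|
        ≤ |p| * ((|p - 2| * jap u ^ (p - 2 - 1) * ‖h‖) * (jap u * ‖h‖)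
            + jap u ^ (p - 2) * ‖h‖ ^ 2) := by
          gcongr
          refine (abs_add_le _ _).trans ?_
          rw [abs_mul, abs_of_nonneg (by positivity : 0 ≤ jap u ^ (p - 2) * ‖h‖ ^ 2)]
          gcongr
      _ = |p| * ((|p - 2| + 1) * jap u ^ (p - 2) * ‖h‖ ^ 2) := by
          rw [← e1]
          ring
      _ ≤ |p| * ((|p - 2| + 1) * (2 ^ |p - 2| * jap v ^ p) * ‖h‖ ^ 2) := by gcongr
      _ = M := by
          rw [hM]
          ring
  have first : ∀ t ∈ Set.Icc (0 : ℝ) 1,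
      ‖japDeriv (v + t • h) h p - japDeriv v h p‖ ≤ M := by
    intro t ht
    have := norm_image_sub_le_of_norm_deriv_le_segment'
      (fun x _ => (hasDerivAt_japDeriv v h p x).hasDerivWithinAt)
      (fun x hx => second x (Set.Ico_subset_Icc_self hx)) t ht
    simp only [zero_smul, add_zero, sub_zero] at this
    exact this.trans (mul_le_of_le_one_right hM0 ht.2)
  have := norm_image_sub_le_of_norm_deriv_le_segment_01'
    (f := fun t : ℝ => jap (v + t • h) ^ p - t * japDeriv v h p)
    (fun x _ => ((hasDerivAt_jap_rpow v h p x).sub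
      ((hasDerivAt_id x).mul_const (japDeriv v h p))).hasDerivWithinAt)
    (fun x hx => by simpa using first x (Set.Ico_subset_Icc_self hx))
  simp only [one_smul, one_mul, zero_smul, add_zero, zero_mul, sub_zero, Real.norm_eq_abs] at this
  rwa [show jap (v + h) ^ p - jap v ^ p - japDeriv v h p =
    jap (v + h) ^ p - japDeriv v h p - jap v ^ p by ring]

/-- Off the diagonal, either the brackets are comparable or the kernel is dominated by a
rank-one kernel. -/
lemma jap_rpow_mul_norm_rpow_le {p a D : ℝ} (hD : 0 ≤ D) (ha : 0 ≤ a) (ha1 : 2 * a ≤ D)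
    (ha2 : |p| + a ≤ D) (hh : h ≠ 0) :
    jap v ^ p * jap (v + h) ^ (-p) * ‖h‖ ^ (-D) ≤
      2 ^ |p| * ‖h‖ ^ (-D) + 2 ^ D * (jap v ^ (-a) * jap (v + h) ^ (-a)) := by
  have hn : 0 < ‖h‖ := norm_pos_iff.2 hh
  have hnD := Real.rpow_pos_of_pos hn (-D)
  have hx1 := one_le_jap v
  have hy1 := one_le_jap (v + h)
  have hxy := jap_add_le v h
  have hyx := jap_le_add_norm v h
  set x := jap v
  set y := jap (v + h)
  have hx : 0 < x := by linarith
  have hy : 0 < y := by linarith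
  by_cases hc : x ≤ 2 * y ∧ y ≤ 2 * x
  · have h1 := rpow_le_of_comparable hx hy hc.1 hc.2 p
    have : x ^ p * y ^ (-p) ≤ 2 ^ |p| := by
      rw [Real.rpow_neg hy.le, ← div_eq_mul_inv, div_le_iff₀ (by positivity)]
      exact h1
    have h3 : 0 ≤ (2 : ℝ) ^ D * (x ^ (-a) * y ^ (-a)) := by positivity
    nlinarith [mul_le_mul_of_nonneg_right this hnD.le]
  · have hmax : max x y ≤ 2 * ‖h‖ := by
      rw [not_and_or, not_le, not_le] at hc
      rcases hc with hc | hc <;> exact max_le (by linarith) (by linarith)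
    set m := max x y with hm
    have hm1 : 1 ≤ m := hx1.trans (le_max_left _ _)
    have hm0 : 0 < m := by linarith
    have hmD : ‖h‖ ^ (-D) ≤ 2 ^ D * m ^ (-D) := by
      have := Real.rpow_le_rpow_of_nonpos (z := -D) (by positivity : 0 < 2⁻¹ * m)
        (by linarith : 2⁻¹ * m ≤ ‖h‖) (by linarith)
      rwa [Real.mul_rpow (by norm_num) hm0.le, Real.inv_rpow (by norm_num),
        ← Real.rpow_neg (by norm_num : (0 : ℝ) ≤ 2), neg_neg] at this
    have up : ∀ z : ℝ, 1 ≤ z → z ≤ m → ∀ q : ℝ, z ^ q ≤ m ^ (max q 0) := fun z hz hzm q =>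
      (Real.rpow_le_rpow_of_exponent_le hz (le_max_left q 0)).trans
        (Real.rpow_le_rpow (by linarith) hzm (le_max_right q 0))
    have hprod : x ^ (p + a) * y ^ (-p + a) ≤ m ^ D := by
      calc x ^ (p + a) * y ^ (-p + a) ≤ m ^ (max (p + a) 0) * m ^ (max (-p + a) 0) := by
            gcongr
            · exact up x hx1 (le_max_left _ _) _
            · exact up y hy1 (le_max_right _ _) _
        _ = m ^ (max (p + a) 0 + max (-p + a) 0) := (Real.rpow_add hm0 _ _).symm
        _ ≤ m ^ D := by
            refine Real.rpow_le_rpow_of_exponent_le hm1 ?_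
            have := le_abs_self p
            have := neg_le_abs p
            rcases max_cases (p + a) 0 with h1 | h1 <;>
              rcases max_cases (-p + a) 0 with h2 | h2 <;> linarith
    have hkey : x ^ p * y ^ (-p) * m ^ (-D) ≤ x ^ (-a) * y ^ (-a) := by
      rw [Real.rpow_add hx, Real.rpow_add hy] at hprod
      rw [Real.rpow_neg hm0.le, Real.rpow_neg hx.le a, Real.rpow_neg hy.le a, ← mul_inv,
        ← div_eq_mul_inv, div_le_iff₀ (by positivity), inv_mul_eq_div,
        le_div_iff₀ (by positivity)]
      linarith
    have h2D : (0 : ℝ) < 2 ^ D := by positivity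
    calc x ^ p * y ^ (-p) * ‖h‖ ^ (-D) ≤ x ^ p * y ^ (-p) * (2 ^ D * m ^ (-D)) := by gcongr
      _ = 2 ^ D * (x ^ p * y ^ (-p) * m ^ (-D)) := by ring
      _ ≤ 2 ^ D * (x ^ (-a) * y ^ (-a)) := by gcongr
      _ ≤ _ := le_add_of_nonneg_left (by positivity)

end Bracket

section Kernel

variable {d : ℕ}

/-- The radial weight `|h| ^ (2 - d - 2s)` near the origin and `|h| ^ (-d - 2s)` away from it. -/
noncomputable def radialWeight (s : ℝ) (h : EuclideanSpace ℝ (Fin d)) : ℝ :=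
  if ‖h‖ ≤ 1 then ‖h‖ ^ (2 - ((d : ℝ) + 2 * s)) else ‖h‖ ^ (-((d : ℝ) + 2 * s))

lemma radialWeight_nonneg (s : ℝ) (h : EuclideanSpace ℝ (Fin d)) : 0 ≤ radialWeight s h := by
  unfold radialWeight
  split_ifs <;> positivity

lemma integrable_radialWeight (hd : 1 ≤ d) {s : ℝ} (hs0 : 0 < s) (hs1 : s < 1) :
    Integrable (radialWeight (d := d) s) := by
  have : Nontrivial (EuclideanSpace ℝ (Fin d)) := by
    have : Nonempty (Fin d) := ⟨⟨0, hd⟩⟩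
    infer_instance
  have key := integrable_fun_norm_addHaar (E := EuclideanSpace ℝ (Fin d)) volume
    (f := fun y : ℝ => if y ≤ 1 then y ^ (2 - ((d : ℝ) + 2 * s)) else y ^ (-((d : ℝ) + 2 * s)))
  unfold radialWeight
  rw [key, finrank_euclideanSpace_fin, ← Set.Ioc_union_Ioi_eq_Ioi zero_le_one]
  have pow_mul : ∀ y : ℝ, 0 < y → ∀ q : ℝ, y ^ (d - 1) * y ^ q = y ^ ((d : ℝ) - 1 + q) := by
    intro y hy q
    rw [Real.rpow_add hy, ← Real.rpow_natCast, Nat.cast_sub hd, Nat.cast_one]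
  refine IntegrableOn.union ?_ ?_
  · have h1 : IntegrableOn (fun y : ℝ => y ^ (1 - 2 * s)) (Set.Ioc 0 1) :=
      (intervalIntegrable_iff_integrableOn_Ioc_of_le zero_le_one).1
        (intervalIntegral.intervalIntegrable_rpow' (by linarith))
    refine h1.congr_fun (fun y hy => ?_) measurableSet_Ioc
    simp only [if_pos hy.2, smul_eq_mul, pow_mul y hy.1]
    congr 1
    ring
  · have h1 : IntegrableOn (fun y : ℝ => y ^ (-1 - 2 * s)) (Set.Ioi 1) :=
      integrableOn_Ioi_rpow_of_lt (by linarith) one_pos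
    refine h1.congr_fun (fun y hy => ?_) measurableSet_Ioi
    have hy : 1 < y := hy
    simp only [if_neg hy.not_ge, smul_eq_mul, pow_mul y (one_pos.trans hy)]
    congr 1
    ring

lemma measurable_radialWeight (s : ℝ) : Measurable (radialWeight (d := d) s) := by
  unfold radialWeight
  refine Measurable.ite (measurableSet_le measurable_norm measurable_const) ?_ ?_ <;> fun_prop

/-- The integrand of the commutator at displacement `h`, with its odd singular part removed. -/
noncomputable def regularizedIntegrand (s p : ℝ) (g : EuclideanSpace ℝ (Fin d) → ℝ)
    (v h : EuclideanSpace ℝ (Fin d)) : ℝ :=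
  ((jap (v + h) ^ p - jap v ^ p) * g (v + h) - if ‖h‖ ≤ 1 then japDeriv v h p * g v else 0) /
    ‖h‖ ^ ((d : ℝ) + 2 * s)

lemma measurable_regularizedIntegrand (s p : ℝ) {g : EuclideanSpace ℝ (Fin d) → ℝ}
    (hg : Continuous g) (v : EuclideanSpace ℝ (Fin d)) :
    Measurable (regularizedIntegrand s p g v) := by
  have h1 : Measurable fun h => (jap (v + h) ^ p - jap v ^ p) * g (v + h) := by
    have := (continuous_jap_rpow (d := d) p).comp (continuous_const_add v)
    exact ((this.sub continuous_const).mul (hg.comp (continuous_const_add v))).measurable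
  have h2 : Measurable fun h => if ‖h‖ ≤ 1 then japDeriv v h p * g v else 0 :=
    Measurable.ite (measurableSet_le measurable_norm measurable_const)
      ((continuous_japDeriv v p).mul continuous_const).measurable measurable_const
  unfold regularizedIntegrand
  fun_prop

lemma abs_sub_le_norm_mul_integral_fderiv {E : Type*} [NormedAddCommGroup E] [NormedSpace ℝ E]
    {g : E → ℝ} (hg : ContDiff ℝ 1 g) (v h : E) :
    |g (v + h) - g v| ≤ ‖h‖ * ∫ t in (0 : ℝ)..1, ‖fderiv ℝ g (v + t • h)‖ := by
  have hc : Continuous fun t : ℝ => fderiv ℝ g (v + t • h) :=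
    (hg.continuous_fderiv one_ne_zero).comp (by fun_prop)
  have hderiv : ∀ t : ℝ, HasDerivAt (fun t : ℝ => g (v + t • h)) (fderiv ℝ g (v + t • h) h) t := by
    intro t
    have h0 : HasDerivAt (fun t : ℝ => v + t • h) h t := by
      simpa using ((hasDerivAt_id t).smul_const h).const_add v
    exact ((hg.differentiable one_ne_zero _).hasFDerivAt).comp_hasDerivAt t h0
  have hc' : Continuous fun t : ℝ => fderiv ℝ g (v + t • h) h := hc.clm_apply continuous_const
  have := intervalIntegral.integral_eq_sub_of_hasDerivAt (a := 0) (b := 1)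
    (fun t _ => hderiv t) (hc'.intervalIntegrable 0 1)
  simp only [one_smul, zero_smul, add_zero] at this
  rw [← this, ← intervalIntegral.integral_const_mul, ← Real.norm_eq_abs]
  refine intervalIntegral.norm_integral_le_of_norm_le zero_le_one (.of_forall fun t _ => ?_)
    ((continuous_const.mul hc.norm).intervalIntegrable 0 1)
  rw [mul_comm]
  exact (fderiv ℝ g (v + t • h)).le_opNorm h

/-- A constant dominating all those in the pointwise kernel estimates. -/
noncomputable def kernelConst (d : ℕ) (s p : ℝ) : ℝ :=
  |p| * (|p - 2| + 1) * 2 ^ |p - 2| * 2 ^ |p| + |p| * 2 ^ |p - 1| + (1 + 2 ^ |p|) +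
    2 ^ ((d : ℝ) + 2 * s)

lemma abs_regularizedIntegrand_le {s p a : ℝ} (hs : 0 < s) (ha : 0 ≤ a)
    (ha1 : 2 * a ≤ d + 2 * s) (ha2 : |p| + a ≤ d + 2 * s)
    {g : EuclideanSpace ℝ (Fin d) → ℝ} (hg : ContDiff ℝ 1 g) (v h : EuclideanSpace ℝ (Fin d)) :
    |regularizedIntegrand s p g v h| ≤ kernelConst d s p *
      (radialWeight s h * (jap (v + h) ^ p * |g (v + h)|) +
        radialWeight s h *
          (∫ t in (0 : ℝ)..1, jap (v + t • h) ^ (p - 1) * ‖fderiv ℝ g (v + t • h)‖) +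
        jap v ^ (-a) * (jap (v + h) ^ (-a) * (jap (v + h) ^ p * |g (v + h)|))) := by
  have hfc : Continuous fun t : ℝ => ‖fderiv ℝ g (v + t • h)‖ :=
    ((hg.continuous_fderiv one_ne_zero).comp (by fun_prop)).norm
  have hGc : Continuous fun t : ℝ => jap (v + t • h) ^ (p - 1) * ‖fderiv ℝ g (v + t • h)‖ :=
    ((continuous_jap_rpow (p - 1)).comp (by fun_prop : Continuous fun t : ℝ => v + t • h)).mul hfc
  set D := (d : ℝ) + 2 * s with hDdef
  have hD : 0 < D := by positivity
  set I := ∫ t in (0 : ℝ)..1, jap (v + t • h) ^ (p - 1) * ‖fderiv ℝ g (v + t • h)‖ with hI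
  have hj := fun (u : EuclideanSpace ℝ (Fin d)) (q : ℝ) => Real.rpow_pos_of_pos (jap_pos u) q
  have hI0 : 0 ≤ I := intervalIntegral.integral_nonneg zero_le_one fun t _ =>
    mul_nonneg (hj _ _).le (norm_nonneg _)
  have hk := radialWeight_nonneg s h
  have hF : 0 ≤ jap (v + h) ^ p * |g (v + h)| := mul_nonneg (hj _ _).le (abs_nonneg _)
  have hR : 0 ≤ jap v ^ (-a) * (jap (v + h) ^ (-a) * (jap (v + h) ^ p * |g (v + h)|)) :=
    mul_nonneg (hj _ _).le (mul_nonneg (hj _ _).le hF)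
  have A1 : 0 ≤ |p| * (|p - 2| + 1) * 2 ^ |p - 2| * 2 ^ |p| := by positivity
  have A2 : 0 ≤ |p| * 2 ^ |p - 1| := by positivity
  have A3 : (0 : ℝ) ≤ 1 + 2 ^ |p| := by positivity
  have A4 : (0 : ℝ) ≤ 2 ^ D := by positivity
  have combine : ∀ c₁ c₂ c₃ : ℝ, c₁ ≤ kernelConst d s p → c₂ ≤ kernelConst d s p →
      c₃ ≤ kernelConst d s p →
      c₁ * (radialWeight s h * (jap (v + h) ^ p * |g (v + h)|)) + c₂ * (radialWeight s h * I) +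
        c₃ * (jap v ^ (-a) * (jap (v + h) ^ (-a) * (jap (v + h) ^ p * |g (v + h)|))) ≤
      kernelConst d s p * (radialWeight s h * (jap (v + h) ^ p * |g (v + h)|) +
        radialWeight s h * I +
        jap v ^ (-a) * (jap (v + h) ^ (-a) * (jap (v + h) ^ p * |g (v + h)|))) := by
    intro c₁ c₂ c₃ h1 h2 h3
    rw [mul_add, mul_add]
    gcongr
  rcases eq_or_ne h 0 with rfl | hh
  · refine le_trans ?_ (combine 0 0 0 ?_ ?_ ?_)
    · simp [regularizedIntegrand, japDeriv]
    all_goals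
      rw [kernelConst]
      linarith
  have hn : 0 < ‖h‖ := norm_pos_iff.2 hh
  have hnD := Real.rpow_pos_of_pos hn D
  by_cases h1 : ‖h‖ ≤ 1
  · have hw : radialWeight s h = ‖h‖ ^ 2 / ‖h‖ ^ D := by
      rw [radialWeight, if_pos h1, Real.rpow_sub hn, Real.rpow_two]
    refine le_trans ?_ (combine (|p| * (|p - 2| + 1) * 2 ^ |p - 2| * 2 ^ |p|)
      (|p| * 2 ^ |p - 1|) 0 ?_ ?_ ?_)
    · have taylor := abs_jap_rpow_sub_sub_le v h p h1
      have comp := jap_rpow_le_of_norm_le_one v h h1 p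
      have lin := abs_japDeriv_le v h p
      have incr := abs_sub_le_norm_mul_integral_fderiv hg v h
      have hint : jap v ^ (p - 1) * (∫ t in (0 : ℝ)..1, ‖fderiv ℝ g (v + t • h)‖) ≤
          2 ^ |p - 1| * I := by
        rw [hI, ← intervalIntegral.integral_const_mul, ← intervalIntegral.integral_const_mul]
        refine intervalIntegral.integral_mono_on zero_le_one
          ((continuous_const.mul hfc).intervalIntegrable 0 1)
          ((continuous_const.mul hGc).intervalIntegrable 0 1) fun t ht => ?_
        rw [← mul_assoc]
        gcongr
        refine jap_rpow_le_of_norm_le_one v (t • h) ?_ (p - 1)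
        rw [norm_smul, Real.norm_of_nonneg ht.1]
        exact mul_le_one₀ ht.2 hn.le h1
      rw [regularizedIntegrand, if_pos h1, ← hDdef, abs_div, abs_of_pos hnD, hw, zero_mul, add_zero]
      rw [div_le_iff₀ hnD]
      have split : (jap (v + h) ^ p - jap v ^ p) * g (v + h) - japDeriv v h p * g v =
          (jap (v + h) ^ p - jap v ^ p - japDeriv v h p) * g (v + h) +
            japDeriv v h p * (g (v + h) - g v) := by ring
      rw [split]
      set N := ∫ t in (0 : ℝ)..1, ‖fderiv ℝ g (v + t • h)‖
      have hN : 0 ≤ N := intervalIntegral.integral_nonneg zero_le_one fun t _ => norm_nonneg _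
      have hjv := hj v p
      have hjv1 := hj v (p - 1)
      calc |(jap (v + h) ^ p - jap v ^ p - japDeriv v h p) * g (v + h) +
            japDeriv v h p * (g (v + h) - g v)|
          ≤ |jap (v + h) ^ p - jap v ^ p - japDeriv v h p| * |g (v + h)| +
            |japDeriv v h p| * |g (v + h) - g v| := by
            rw [← abs_mul, ← abs_mul]
            exact abs_add_le _ _
        _ ≤ (|p| * (|p - 2| + 1) * 2 ^ |p - 2| * (2 ^ |p| * jap (v + h) ^ p) * ‖h‖ ^ 2) *
              |g (v + h)| + (|p| * jap v ^ (p - 1) * ‖h‖) * (‖h‖ * N) := by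
            gcongr
            exact taylor.trans (by gcongr)
        _ = (|p| * (|p - 2| + 1) * 2 ^ |p - 2| * (2 ^ |p| * jap (v + h) ^ p) * ‖h‖ ^ 2) *
              |g (v + h)| + |p| * ‖h‖ ^ 2 * (jap v ^ (p - 1) * N) := by ring
        _ ≤ (|p| * (|p - 2| + 1) * 2 ^ |p - 2| * (2 ^ |p| * jap (v + h) ^ p) * ‖h‖ ^ 2) *
              |g (v + h)| + |p| * ‖h‖ ^ 2 * (2 ^ |p - 1| * I) := by gcongr
        _ = _ := by
            field_simp
    all_goals
      rw [kernelConst]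
      linarith
  · have hw : radialWeight s h = ‖h‖ ^ (-D) := by rw [radialWeight, if_neg h1]
    refine le_trans ?_ (combine (1 + 2 ^ |p|) 0 (2 ^ D) ?_ ?_ ?_)
    · have off := jap_rpow_mul_norm_rpow_le v h hD.le ha ha1 ha2 hh
      rw [regularizedIntegrand, if_neg h1, ← hDdef, sub_zero, abs_div, abs_of_pos hnD, hw,
        zero_mul, add_zero, div_eq_mul_inv, ← Real.rpow_neg hn.le, abs_mul]
      have hjj : jap (v + h) ^ (-p) * jap (v + h) ^ p = 1 := by
        rw [← Real.rpow_add (jap_pos _), neg_add_cancel, Real.rpow_zero]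
      have hnD' := Real.rpow_pos_of_pos hn (-D)
      have tri : |jap (v + h) ^ p - jap v ^ p| ≤ jap (v + h) ^ p + jap v ^ p := by
        have := hj v p
        have := hj (v + h) p
        rw [abs_le]
        constructor <;> linarith
      calc |jap (v + h) ^ p - jap v ^ p| * |g (v + h)| * ‖h‖ ^ (-D)
          ≤ (jap (v + h) ^ p + jap v ^ p) * |g (v + h)| * ‖h‖ ^ (-D) := by gcongr
        _ = (jap (v + h) ^ p + jap v ^ p * (jap (v + h) ^ (-p) * jap (v + h) ^ p)) *
              |g (v + h)| * ‖h‖ ^ (-D) := by rw [hjj, mul_one]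
        _ = ‖h‖ ^ (-D) * (jap (v + h) ^ p * |g (v + h)|) +
              (jap v ^ p * jap (v + h) ^ (-p) * ‖h‖ ^ (-D)) *
                (jap (v + h) ^ p * |g (v + h)|) := by ring
        _ ≤ ‖h‖ ^ (-D) * (jap (v + h) ^ p * |g (v + h)|) +
              (2 ^ |p| * ‖h‖ ^ (-D) + 2 ^ D * (jap v ^ (-a) * jap (v + h) ^ (-a))) *
                (jap (v + h) ^ p * |g (v + h)|) := by gcongr
        _ = _ := by ring
    all_goals
      rw [kernelConst]
      linarith

end Kernel

section LebesgueBounds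

lemma eLpNorm_two_ennreal {α : Type*} [MeasurableSpace α] (μ : Measure α) (f : α → ENNReal) :
    eLpNorm f 2 μ = (∫⁻ x, f x ^ (2 : ℝ) ∂μ) ^ (1 / 2 : ℝ) := by
  simp [eLpNorm_eq_lintegral_rpow_enorm_toReal]

/-- Minkowski's inequality for superpositions of translates. -/
lemma eLpNorm_lintegral_add_le {E : Type*} [NormedAddCommGroup E] [MeasurableSpace E]
    [BorelSpace E] [SecondCountableTopology E] (μ ν : Measure E) [μ.IsAddRightInvariant]
    [SFinite μ] [IsFiniteMeasure ν] {F : E → ENNReal} (hF : Measurable F) :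
    eLpNorm (fun v => ∫⁻ h, F (v + h) ∂ν) 2 μ ≤ ν Set.univ * eLpNorm F 2 μ := by
  have cs : ∀ v, (∫⁻ h, F (v + h) ∂ν) ^ (2 : ℝ) ≤
      ν Set.univ * ∫⁻ h, F (v + h) ^ (2 : ℝ) ∂ν := by
    intro v
    have hm : Measurable fun h => F (v + h) := hF.comp (measurable_const_add v)
    have := eLpNorm_le_eLpNorm_mul_rpow_measure_univ (μ := ν) (p := 1) (q := 2)
      (by norm_num) hm.aestronglyMeasurable
    rw [eLpNorm_one_eq_lintegral_enorm, eLpNorm_two_ennreal] at this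
    simp only [enorm_eq_self, ENNReal.toReal_one, ENNReal.toReal_ofNat] at this
    calc (∫⁻ h, F (v + h) ∂ν) ^ (2 : ℝ) ≤ _ := ENNReal.rpow_le_rpow this zero_le_two
      _ = _ := by
        rw [ENNReal.mul_rpow_of_nonneg _ _ zero_le_two, ← ENNReal.rpow_mul, ← ENNReal.rpow_mul,
          mul_comm]
        norm_num
  rw [eLpNorm_two_ennreal, eLpNorm_two_ennreal]
  have hm : Measurable (Function.uncurry fun v h : E => F (v + h) ^ (2 : ℝ)) :=
    (hF.comp measurable_add).pow_const _
  calc (∫⁻ v, (∫⁻ h, F (v + h) ∂ν) ^ (2 : ℝ) ∂μ) ^ (1 / 2 : ℝ)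
      ≤ (∫⁻ v, ν Set.univ * ∫⁻ h, F (v + h) ^ (2 : ℝ) ∂ν ∂μ) ^ (1 / 2 : ℝ) :=
        ENNReal.rpow_le_rpow (lintegral_mono cs) (by norm_num)
    _ = (ν Set.univ * ∫⁻ h, ∫⁻ v, F (v + h) ^ (2 : ℝ) ∂μ ∂ν) ^ (1 / 2 : ℝ) := by
        rw [lintegral_const_mul' _ _ (measure_ne_top ν _), lintegral_lintegral_swap hm.aemeasurable]
    _ = (ν Set.univ ^ (2 : ℝ) * ∫⁻ v, F v ^ (2 : ℝ) ∂μ) ^ (1 / 2 : ℝ) := by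
        simp only [lintegral_add_right_eq_self (μ := μ) (fun v => F v ^ (2 : ℝ)), lintegral_const]
        rw [ENNReal.rpow_two, sq]
        ring_nf
    _ = ν Set.univ * (∫⁻ v, F v ^ (2 : ℝ) ∂μ) ^ (1 / 2 : ℝ) := by
        rw [ENNReal.mul_rpow_of_nonneg _ _ (by norm_num), ← ENNReal.rpow_mul]
        norm_num

lemma eLpNorm_rank_one_le {α : Type*} [MeasurableSpace α] (μ : Measure α) {W F : α → ENNReal}
    (hW : Measurable W) (hF : Measurable F) :
    eLpNorm (fun v => W v * ∫⁻ w, W w * F w ∂μ) 2 μ ≤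
      eLpNorm W 2 μ * eLpNorm W 2 μ * eLpNorm F 2 μ := by
  have h1 : ∫⁻ w, W w * F w ∂μ ≤ eLpNorm W 2 μ * eLpNorm F 2 μ := by
    rw [eLpNorm_two_ennreal, eLpNorm_two_ennreal]
    exact ENNReal.lintegral_mul_le_Lp_mul_Lq μ Real.HolderConjugate.two_two
      hW.aemeasurable hF.aemeasurable
  have h2 : ∀ c : ENNReal, eLpNorm (fun v => W v * c) 2 μ = eLpNorm W 2 μ * c := by
    intro c
    simp only [eLpNorm_two_ennreal, ENNReal.mul_rpow_of_nonneg _ _ zero_le_two]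
    rw [lintegral_mul_const _ (hW.pow_const _), ENNReal.mul_rpow_of_nonneg _ _ (by norm_num),
      ← ENNReal.rpow_mul]
    norm_num
  rw [h2, mul_assoc]
  gcongr

lemma eLpNorm_two_le_of_enorm_le_mul_add {α : Type*} [MeasurableSpace α] {μ : Measure α}
    {f : α → ℝ} {A B R : α → ENNReal} (hA : Measurable A) (hB : Measurable B) (hR : Measurable R)
    {c : ENNReal} (hc : c ≠ ⊤) (hf : ∀ x, ‖f x‖ₑ ≤ c * (A x + B x + R x)) :
    eLpNorm f 2 μ ≤ c * (eLpNorm A 2 μ + eLpNorm B 2 μ + eLpNorm R 2 μ) := by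
  have hsum : eLpNorm (A + B + R) 2 μ ≤ eLpNorm A 2 μ + eLpNorm B 2 μ + eLpNorm R 2 μ := by
    refine (eLpNorm_add_le (hA.add hB).aestronglyMeasurable hR.aestronglyMeasurable
      one_le_two).trans ?_
    gcongr
    exact eLpNorm_add_le hA.aestronglyMeasurable hB.aestronglyMeasurable one_le_two
  calc eLpNorm f 2 μ ≤ eLpNorm (fun x => c * (A x + B x + R x)) 2 μ := eLpNorm_mono_enorm hf
    _ = c * eLpNorm (A + B + R) 2 μ := by
        simp only [eLpNorm_two_ennreal, ENNReal.mul_rpow_of_nonneg _ _ zero_le_two, Pi.add_apply]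
        rw [lintegral_const_mul' _ _ (ENNReal.rpow_ne_top_of_nonneg zero_le_two hc),
          ENNReal.mul_rpow_of_nonneg _ _ (by norm_num), ← ENNReal.rpow_mul]
        norm_num
    _ ≤ _ := by gcongr

end LebesgueBounds

section Commutator

variable {d : ℕ}

lemma eLpNorm_jap_rpow_ne_top {a : ℝ} (ha : (d : ℝ) / 2 < a) :
    eLpNorm (fun v : EuclideanSpace ℝ (Fin d) => ‖jap v ^ (-a)‖ₑ) 2 volume ≠ ⊤ := by
  have hi := integrable_rpow_neg_one_add_norm_sq (E := EuclideanSpace ℝ (Fin d)) (μ := volume)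
    (r := 2 * a) (by rw [finrank_euclideanSpace_fin]; linarith)
  rw [eLpNorm_two_ennreal]
  refine ENNReal.rpow_ne_top_of_nonneg (by norm_num) (ne_of_lt ?_)
  refine lt_of_eq_of_lt (lintegral_congr fun v => ?_) hi.hasFiniteIntegral
  have : (1 + ‖v‖ ^ 2) ^ (-(2 * a) / 2) = (jap v ^ (-a)) ^ 2 := by
    rw [← jap_sq, ← Real.rpow_natCast, ← Real.rpow_natCast, ← Real.rpow_mul (jap_pos v).le,
      ← Real.rpow_mul (jap_pos v).le]
    congr 1
    push_cast
    ring
  simp only [this, enorm_pow, ENNReal.rpow_two]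

/-- Weighted derivatives of Schwartz functions decay faster than any power. -/
lemma SchwartzMap.exists_jap_rpow_mul_le (g : SchwartzMap (EuclideanSpace ℝ (Fin d)) ℝ) (n : ℕ)
    (q r : ℝ) : ∃ M : ℝ, ∀ v, jap v ^ q * ‖iteratedFDeriv ℝ n g v‖ ≤ M * (1 + ‖v‖) ^ (-r) := by
  obtain ⟨k, hk⟩ := exists_nat_ge (max q 0 + r)
  refine ⟨2 ^ k * ((Finset.Iic (k, n)).sup fun m => SchwartzMap.seminorm ℝ m.1 m.2) g,
    fun v => ?_⟩
  have hb := SchwartzMap.one_add_le_sup_seminorm_apply (𝕜 := ℝ) (m := (k, n)) le_rfl le_rfl g v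
  have h1 : 1 ≤ 1 + ‖v‖ := by linarith [norm_nonneg v]
  have h0 : 0 < 1 + ‖v‖ := by linarith
  rw [Real.rpow_neg h0.le, ← div_eq_mul_inv, le_div_iff₀ (by positivity)]
  refine le_trans ?_ hb
  have hj : jap v ^ q ≤ (1 + ‖v‖) ^ max q 0 :=
    (Real.rpow_le_rpow_of_exponent_le (one_le_jap v) (le_max_left q 0)).trans
      (Real.rpow_le_rpow (jap_pos v).le (jap_le_one_add_norm v) (le_max_right q 0))
  calc jap v ^ q * ‖iteratedFDeriv ℝ n g v‖ * (1 + ‖v‖) ^ r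
      ≤ (1 + ‖v‖) ^ max q 0 * ‖iteratedFDeriv ℝ n g v‖ * (1 + ‖v‖) ^ r := by gcongr
    _ = (1 + ‖v‖) ^ (max q 0 + r) * ‖iteratedFDeriv ℝ n g v‖ := by
        rw [Real.rpow_add h0]
        ring
    _ ≤ (1 + ‖v‖) ^ k * ‖iteratedFDeriv ℝ n g v‖ := by
        gcongr
        rw [← Real.rpow_natCast]
        exact Real.rpow_le_rpow_of_exponent_le h1 hk

lemma kernelConst_pos (d : ℕ) (s p : ℝ) : 0 < kernelConst d s p := by
  unfold kernelConst
  positivity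

lemma enorm_regularizedIntegrand_le {s p a : ℝ} (hs : 0 < s) (ha : 0 ≤ a)
    (ha1 : 2 * a ≤ d + 2 * s) (ha2 : |p| + a ≤ d + 2 * s)
    {g : EuclideanSpace ℝ (Fin d) → ℝ} (hg : ContDiff ℝ 1 g) (v h : EuclideanSpace ℝ (Fin d)) :
    ‖regularizedIntegrand s p g v h‖ₑ ≤ ENNReal.ofReal (kernelConst d s p) *
      (‖radialWeight s h‖ₑ * ‖jap (v + h) ^ p * g (v + h)‖ₑ +
        ‖radialWeight s h‖ₑ * (∫⁻ t in Set.Ioc (0 : ℝ) 1,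
          ‖jap (v + t • h) ^ (p - 1) * ‖fderiv ℝ g (v + t • h)‖‖ₑ) +
        ‖jap v ^ (-a)‖ₑ * (‖jap (v + h) ^ (-a)‖ₑ * ‖jap (v + h) ^ p * g (v + h)‖ₑ)) := by
  have hj := fun (u : EuclideanSpace ℝ (Fin d)) (q : ℝ) => Real.rpow_pos_of_pos (jap_pos u) q
  have hGc : Continuous fun t : ℝ => jap (v + t • h) ^ (p - 1) * ‖fderiv ℝ g (v + t • h)‖ := by
    have hv : Continuous fun t : ℝ => v + t • h := by fun_prop
    exact ((continuous_jap_rpow (p - 1)).comp hv).mul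
      ((hg.continuous_fderiv one_ne_zero).comp hv).norm
  have hG0 : ∀ t : ℝ, 0 ≤ jap (v + t • h) ^ (p - 1) * ‖fderiv ℝ g (v + t • h)‖ := fun t =>
    mul_nonneg (hj _ _).le (norm_nonneg _)
  have hI : ∫⁻ t in Set.Ioc (0 : ℝ) 1,
      ‖jap (v + t • h) ^ (p - 1) * ‖fderiv ℝ g (v + t • h)‖‖ₑ =
      ‖∫ t in (0 : ℝ)..1, jap (v + t • h) ^ (p - 1) * ‖fderiv ℝ g (v + t • h)‖‖ₑ := by
    rw [intervalIntegral.integral_of_le zero_le_one, Real.enorm_of_nonneg (integral_nonneg hG0),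
      ofReal_integral_eq_lintegral_ofReal (hGc.integrableOn_Ioc) (.of_forall hG0)]
    exact lintegral_congr fun t => Real.enorm_of_nonneg (hG0 t)
  have hF : ‖jap (v + h) ^ p * g (v + h)‖ₑ = ‖jap (v + h) ^ p * |g (v + h)|‖ₑ := by
    rw [enorm_mul, enorm_mul, Real.enorm_abs]
  have hk := radialWeight_nonneg s h
  have hF0 : 0 ≤ jap (v + h) ^ p * |g (v + h)| := mul_nonneg (hj _ _).le (abs_nonneg _)
  have hI0 : 0 ≤ ∫ t in (0 : ℝ)..1, jap (v + t • h) ^ (p - 1) * ‖fderiv ℝ g (v + t • h)‖ :=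
    intervalIntegral.integral_nonneg zero_le_one fun t _ => hG0 t
  have hb := ENNReal.ofReal_le_ofReal (abs_regularizedIntegrand_le hs ha ha1 ha2 hg v h)
  rw [← Real.enorm_eq_ofReal_abs, ENNReal.ofReal_mul (kernelConst_pos d s p).le] at hb
  rw [hI, hF]
  refine hb.trans_eq ?_
  have w1 := (hj v (-a)).le
  have w2 := (hj (v + h) (-a)).le
  rw [ENNReal.ofReal_add (by positivity) (by positivity),
    ENNReal.ofReal_add (by positivity) (by positivity)]
  simp only [← enorm_mul]
  rw [Real.enorm_of_nonneg (by positivity), Real.enorm_of_nonneg (by positivity),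
    Real.enorm_of_nonneg (by positivity)]

/-- The finite measure with density `radialWeight`. -/
noncomputable def radialMeasure (d : ℕ) (s : ℝ) : Measure (EuclideanSpace ℝ (Fin d)) :=
  volume.withDensity fun h => ‖radialWeight s h‖ₑ

/-- The image of `radialMeasure` under the averaging over all contractions `h ↦ t h`, `0 < t ≤ 1`. -/
noncomputable def contractedMeasure (d : ℕ) (s : ℝ) : Measure (EuclideanSpace ℝ (Fin d)) :=
  ((radialMeasure d s).prod (volume.restrict (Set.Ioc (0 : ℝ) 1))).map fun x => x.2 • x.1

lemma isFiniteMeasure_radialMeasure (hd : 1 ≤ d) {s : ℝ} (hs0 : 0 < s) (hs1 : s < 1) :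
    IsFiniteMeasure (radialMeasure d s) :=
  isFiniteMeasure_withDensity (integrable_radialWeight hd hs0 hs1).hasFiniteIntegral.ne

instance sFinite_radialMeasure (s : ℝ) : SFinite (radialMeasure d s) := by
  unfold radialMeasure
  infer_instance

lemma lintegral_radialMeasure (s : ℝ) {F : EuclideanSpace ℝ (Fin d) → ENNReal}
    (hF : Measurable F) :
    ∫⁻ h, F h ∂radialMeasure d s = ∫⁻ h, ‖radialWeight s h‖ₑ * F h := by
  rw [radialMeasure, lintegral_withDensity_eq_lintegral_mul _ (measurable_radialWeight s).enorm hF]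
  rfl

lemma lintegral_contractedMeasure (s : ℝ) {F : EuclideanSpace ℝ (Fin d) → ENNReal}
    (hF : Measurable F) :
    ∫⁻ h, F h ∂contractedMeasure d s =
      ∫⁻ h, ‖radialWeight s h‖ₑ * ∫⁻ t in Set.Ioc (0 : ℝ) 1, F (t • h) := by
  have hsm : Measurable fun x : EuclideanSpace ℝ (Fin d) × ℝ => x.2 • x.1 :=
    measurable_snd.smul measurable_fst
  have hm : Measurable fun x : EuclideanSpace ℝ (Fin d) × ℝ => F (x.2 • x.1) := hF.comp hsm
  rw [contractedMeasure, lintegral_map hF hsm, lintegral_prod _ hm.aemeasurable,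
    lintegral_radialMeasure s hm.lintegral_prod_right']

lemma lintegral_enorm_regularizedIntegrand_le {s p a : ℝ} (hs : 0 < s) (ha : 0 ≤ a)
    (ha1 : 2 * a ≤ d + 2 * s) (ha2 : |p| + a ≤ d + 2 * s)
    {g : EuclideanSpace ℝ (Fin d) → ℝ} (hg : ContDiff ℝ 1 g) (v : EuclideanSpace ℝ (Fin d)) :
    ∫⁻ h, ‖regularizedIntegrand s p g v h‖ₑ ≤ ENNReal.ofReal (kernelConst d s p) *
      ((∫⁻ h, ‖jap (v + h) ^ p * g (v + h)‖ₑ ∂radialMeasure d s) +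
        (∫⁻ h, ‖jap (v + h) ^ (p - 1) * ‖fderiv ℝ g (v + h)‖‖ₑ ∂contractedMeasure d s) +
        ‖jap v ^ (-a)‖ₑ * ∫⁻ w, ‖jap w ^ (-a)‖ₑ * ‖jap w ^ p * g w‖ₑ) := by
  have hF : Measurable fun v => ‖jap v ^ p * g v‖ₑ :=
    ((continuous_jap_rpow p).mul hg.continuous).measurable.enorm
  have hG : Measurable fun v => ‖jap v ^ (p - 1) * ‖fderiv ℝ g v‖‖ₑ :=
    ((continuous_jap_rpow (p - 1)).mul (hg.continuous_fderiv one_ne_zero).norm).measurable.enorm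
  have hW : Measurable fun v : EuclideanSpace ℝ (Fin d) => ‖jap v ^ (-a)‖ₑ :=
    (continuous_jap_rpow (-a)).measurable.enorm
  have hK : Measurable fun h : EuclideanSpace ℝ (Fin d) => ‖radialWeight s h‖ₑ :=
    (measurable_radialWeight s).enorm
  have hv := measurable_const_add v
  have hFv : Measurable fun h => ‖jap (v + h) ^ p * g (v + h)‖ₑ := hF.comp hv
  have hWF : Measurable fun h => ‖jap (v + h) ^ (-a)‖ₑ * ‖jap (v + h) ^ p * g (v + h)‖ₑ :=
    (hW.comp hv).mul hFv
  have hGv : Measurable fun h => ‖jap (v + h) ^ (p - 1) * ‖fderiv ℝ g (v + h)‖‖ₑ := hG.comp hv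
  have hsm : Measurable fun x : EuclideanSpace ℝ (Fin d) × ℝ => v + x.2 • x.1 :=
    (measurable_snd.smul measurable_fst).const_add v
  have hA : Measurable fun h : EuclideanSpace ℝ (Fin d) => ∫⁻ t in Set.Ioc (0 : ℝ) 1,
      ‖jap (v + t • h) ^ (p - 1) * ‖fderiv ℝ g (v + t • h)‖‖ₑ :=
    (hG.comp hsm).lintegral_prod_right' (ν := volume.restrict (Set.Ioc (0 : ℝ) 1))
  have hKF : Measurable fun h => ‖radialWeight s h‖ₑ * ‖jap (v + h) ^ p * g (v + h)‖ₑ :=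
    hK.mul hFv
  have hKFA : Measurable fun h => ‖radialWeight s h‖ₑ * ‖jap (v + h) ^ p * g (v + h)‖ₑ +
      ‖radialWeight s h‖ₑ * ∫⁻ t in Set.Ioc (0 : ℝ) 1,
        ‖jap (v + t • h) ^ (p - 1) * ‖fderiv ℝ g (v + t • h)‖‖ₑ :=
    hKF.add (hK.mul hA)
  rw [lintegral_radialMeasure s hFv, lintegral_contractedMeasure s hGv,
    ← lintegral_add_left_eq_self (μ := volume) (fun w => _ * ‖jap w ^ p * g w‖ₑ) v,
    ← lintegral_const_mul _ hWF,
    ← lintegral_add_left hKF, ← lintegral_add_left hKFA, ← lintegral_const_mul' _ _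
      ENNReal.ofReal_ne_top]
  exact lintegral_mono fun h => enorm_regularizedIntegrand_le hs ha ha1 ha2 hg v h

lemma isFiniteMeasure_contractedMeasure (hd : 1 ≤ d) {s : ℝ} (hs0 : 0 < s) (hs1 : s < 1) :
    IsFiniteMeasure (contractedMeasure d s) := by
  have := isFiniteMeasure_radialMeasure hd hs0 hs1
  unfold contractedMeasure
  infer_instance

lemma integrable_regularizedIntegrand (hd : 1 ≤ d) {s p a : ℝ} (hs0 : 0 < s) (hs1 : s < 1)
    (ha : 0 ≤ a) (ha1 : 2 * a ≤ d + 2 * s) (ha2 : |p| + a ≤ d + 2 * s)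
    (g : SchwartzMap (EuclideanSpace ℝ (Fin d)) ℝ) (v : EuclideanSpace ℝ (Fin d)) :
    Integrable (regularizedIntegrand s p g v) := by
  have := isFiniteMeasure_radialMeasure hd hs0 hs1
  have := isFiniteMeasure_contractedMeasure hd hs0 hs1
  have hg : ContDiff ℝ 1 g := g.smooth 1
  refine ⟨(measurable_regularizedIntegrand s p hg.continuous v).aestronglyMeasurable, ?_⟩
  refine lt_of_le_of_lt (lintegral_enorm_regularizedIntegrand_le hs0 ha ha1 ha2 hg v) ?_
  have hj := fun (u : EuclideanSpace ℝ (Fin d)) (q : ℝ) => Real.rpow_pos_of_pos (jap_pos u) q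
  have bdd : ∀ (ν : Measure (EuclideanSpace ℝ (Fin d))) [IsFiniteMeasure ν]
      (f : EuclideanSpace ℝ (Fin d) → ℝ) (M : ℝ), (∀ u, |f u| ≤ M) →
      ∫⁻ h, ‖f (v + h)‖ₑ ∂ν < ⊤ := by
    intro ν _ f M hM
    refine lt_of_le_of_lt (lintegral_mono (g := fun _ => ENNReal.ofReal M) fun h => ?_) ?_
    · rw [Real.enorm_eq_ofReal_abs]
      exact ENNReal.ofReal_le_ofReal (hM _)
    · rw [lintegral_const]
      exact ENNReal.mul_lt_top ENNReal.ofReal_lt_top (measure_lt_top ν _)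
  refine ENNReal.mul_lt_top ENNReal.ofReal_lt_top
    (ENNReal.add_lt_top.2 ⟨ENNReal.add_lt_top.2 ⟨?_, ?_⟩, ENNReal.mul_lt_top enorm_lt_top ?_⟩)
  · obtain ⟨M, hM⟩ := g.exists_jap_rpow_mul_le 0 p 0
    refine bdd _ (fun u => jap u ^ p * g u) M fun u => ?_
    simpa [abs_mul, abs_of_pos (hj u p)] using hM u
  · obtain ⟨M, hM⟩ := g.exists_jap_rpow_mul_le 1 (p - 1) 0
    refine bdd _ (fun u => jap u ^ (p - 1) * ‖fderiv ℝ g u‖) M fun u => ?_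
    simpa [abs_mul, abs_of_pos (hj u (p - 1)), norm_iteratedFDeriv_one] using hM u
  · obtain ⟨M, hM⟩ := g.exists_jap_rpow_mul_le 0 p (d + 1)
    have hi : Integrable fun u : EuclideanSpace ℝ (Fin d) =>
        M * (1 + ‖u‖) ^ (-((d : ℝ) + 1)) :=
      (integrable_one_add_norm (by simp)).const_mul M
    refine lt_of_le_of_lt (lintegral_mono fun u => ?_) hi.hasFiniteIntegral
    rw [← enorm_mul, enorm_le_iff_norm_le]
    have hw : jap u ^ (-a) ≤ 1 :=
      Real.rpow_le_one_of_one_le_of_nonpos (one_le_jap u) (by linarith)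
    have hMu := hM u
    rw [norm_iteratedFDeriv_zero] at hMu
    rw [norm_mul, norm_mul, Real.norm_of_nonneg (hj u (-a)).le, Real.norm_of_nonneg (hj u p).le]
    calc jap u ^ (-a) * (jap u ^ p * ‖g u‖) ≤ jap u ^ p * ‖g u‖ :=
          mul_le_of_le_one_left (mul_nonneg (hj u p).le (norm_nonneg _)) hw
      _ ≤ _ := hMu.trans (le_abs_self _)

lemma integrableOn_oddPart (hd : 1 ≤ d) {s : ℝ} (p c : ℝ) (hs0 : 0 < s) (hs1 : s < 1)
    (v : EuclideanSpace ℝ (Fin d)) {δ : ℝ} (hδ : 0 < δ) :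
    IntegrableOn (fun h => (if ‖h‖ ≤ 1 then japDeriv v h p * c else 0) / ‖h‖ ^ ((d : ℝ) + 2 * s))
      {h | δ < ‖h‖} := by
  have hm : Measurable fun h => if ‖h‖ ≤ 1 then japDeriv v h p * c else 0 :=
    Measurable.ite (measurableSet_le measurable_norm measurable_const)
      ((continuous_japDeriv v p).mul continuous_const).measurable measurable_const
  have hS : MeasurableSet {h : EuclideanSpace ℝ (Fin d) | δ < ‖h‖} :=
    measurableSet_lt measurable_const measurable_norm
  refine Integrable.mono'
    ((integrable_radialWeight hd hs0 hs1).const_mul (|p| * jap v ^ (p - 1) * |c| / δ)).integrableOn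
    (by fun_prop : Measurable fun h : EuclideanSpace ℝ (Fin d) =>
      (if ‖h‖ ≤ 1 then japDeriv v h p * c else 0) / ‖h‖ ^ ((d : ℝ) + 2 * s)).aestronglyMeasurable
    ((ae_restrict_iff' hS).2 (.of_forall fun h hh => ?_))
  have hh : δ < ‖h‖ := hh
  have hn : 0 < ‖h‖ := hδ.trans hh
  have hj := Real.rpow_pos_of_pos (jap_pos v) (p - 1)
  have hnD := Real.rpow_pos_of_pos hn ((d : ℝ) + 2 * s)
  by_cases h1 : ‖h‖ ≤ 1
  · rw [if_pos h1, radialWeight, if_pos h1, Real.rpow_sub hn, Real.rpow_two, norm_div,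
      Real.norm_of_nonneg hnD.le, ← mul_div_assoc, norm_mul, Real.norm_eq_abs, Real.norm_eq_abs]
    refine div_le_div_of_nonneg_right ?_ hnD.le
    calc |japDeriv v h p| * |c| ≤ |p| * jap v ^ (p - 1) * ‖h‖ * |c| := by
          gcongr
          exact abs_japDeriv_le v h p
      _ = |p| * jap v ^ (p - 1) * |c| / δ * (δ * ‖h‖) := by field_simp
      _ ≤ |p| * jap v ^ (p - 1) * |c| / δ * ‖h‖ ^ 2 := by
          rw [sq]
          gcongr
  · rw [if_neg h1, zero_div, norm_zero]
    have := radialWeight_nonneg s h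
    positivity

lemma setIntegral_oddPart (s p c δ : ℝ) (v : EuclideanSpace ℝ (Fin d)) :
    ∫ h in {h : EuclideanSpace ℝ (Fin d) | δ < ‖h‖},
      (if ‖h‖ ≤ 1 then japDeriv v h p * c else 0) / ‖h‖ ^ ((d : ℝ) + 2 * s) = 0 := by
  rw [← integral_indicator (measurableSet_lt measurable_const measurable_norm)]
  refine self_eq_neg.1 ?_
  rw [← integral_neg, ← integral_neg_eq_self]
  refine integral_congr_ae (.of_forall fun h => ?_)
  by_cases h1 : δ < ‖h‖ <;> by_cases h2 : ‖h‖ ≤ 1 <;>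
    simp [Set.indicator, h1, h2, japDeriv_neg, neg_div]

/-- The truncated integrals converge to the absolutely convergent regularized integral. -/
lemma tendsto_truncated_integral (hd : 1 ≤ d) {s : ℝ} (p : ℝ) (hs0 : 0 < s) (hs1 : s < 1)
    {g : EuclideanSpace ℝ (Fin d) → ℝ} {v : EuclideanSpace ℝ (Fin d)}
    (hi : Integrable (regularizedIntegrand s p g v)) :
    Filter.Tendsto
      (fun δ : ℝ => ∫ w in {w : EuclideanSpace ℝ (Fin d) | δ < ‖v - w‖},
        (jap w ^ p - jap v ^ p) * g w / ‖v - w‖ ^ ((d : ℝ) + 2 * s))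
      (nhdsWithin 0 (Set.Ioi 0)) (nhds (∫ h, regularizedIntegrand s p g v h)) := by
  have : Nontrivial (EuclideanSpace ℝ (Fin d)) := by
    have : Nonempty (Fin d) := ⟨⟨0, hd⟩⟩
    infer_instance
  have cover : AECover (volume : Measure (EuclideanSpace ℝ (Fin d)))
      (nhdsWithin (0 : ℝ) (Set.Ioi 0)) fun δ => {h | δ < ‖h‖} := by
    refine ⟨?_, fun δ => measurableSet_lt measurable_const measurable_norm⟩
    filter_upwards [Measure.ae_ne volume (0 : EuclideanSpace ℝ (Fin d))] with h hh
    exact nhdsWithin_le_nhds (Iio_mem_nhds (norm_pos_iff.2 hh))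
  refine (cover.integral_tendsto_of_countably_generated hi).congr' ?_
  filter_upwards [self_mem_nhdsWithin] with δ hδ
  have hδ : 0 < δ := hδ
  have hodd := integrableOn_oddPart hd p (g v) hs0 hs1 v hδ
  calc ∫ h in {h | δ < ‖h‖}, regularizedIntegrand s p g v h
      = ∫ h in {h | δ < ‖h‖}, (regularizedIntegrand s p g v h +
          (if ‖h‖ ≤ 1 then japDeriv v h p * g v else 0) / ‖h‖ ^ ((d : ℝ) + 2 * s)) := by
        rw [integral_add hi.integrableOn hodd, setIntegral_oddPart, add_zero]
    _ = ∫ h in {h : EuclideanSpace ℝ (Fin d) | δ < ‖h‖},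
          (jap (v + h) ^ p - jap v ^ p) * g (v + h) / ‖h‖ ^ ((d : ℝ) + 2 * s) := by
        simp only [regularizedIntegrand, sub_div, sub_add_cancel]
    _ = _ := by
        rw [← integral_indicator (measurableSet_lt measurable_const measurable_norm),
          ← integral_indicator (measurableSet_lt measurable_const (by fun_prop)),
          ← integral_add_left_eq_self (Set.indicator {w | δ < ‖v - w‖} _) v]
        refine integral_congr_ae (.of_forall fun h => ?_)
        simp [Set.indicator]

lemma exists_eLpNorm_regularizedIntegral_le (hd : 1 ≤ d) {s p a : ℝ} (hs0 : 0 < s) (hs1 : s < 1)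
    (ha : (d : ℝ) / 2 < a) (ha1 : 2 * a ≤ d + 2 * s) (ha2 : |p| + a ≤ d + 2 * s) :
    ∃ C : ℝ, 0 < C ∧ ∀ g : EuclideanSpace ℝ (Fin d) → ℝ, ContDiff ℝ 1 g →
      eLpNorm (fun v => ∫ h, regularizedIntegrand s p g v h) 2 volume ≤
        ENNReal.ofReal C * (eLpNorm (fun v => jap v ^ p * g v) 2 volume +
          eLpNorm (fun v => jap v ^ (p - 1) * ‖fderiv ℝ g v‖) 2 volume) := by
  have := isFiniteMeasure_radialMeasure hd hs0 hs1
  have := isFiniteMeasure_contractedMeasure hd hs0 hs1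
  obtain ⟨N, hN, hNtop⟩ :
      ∃ N, eLpNorm (fun v : EuclideanSpace ℝ (Fin d) => ‖jap v ^ (-a)‖ₑ) 2 volume = N ∧ N ≠ ⊤ :=
    ⟨_, rfl, eLpNorm_jap_rpow_ne_top ha⟩
  obtain ⟨T, hT⟩ :
      ∃ T, T = radialMeasure d s Set.univ + contractedMeasure d s Set.univ + N * N := ⟨_, rfl⟩
  have hTtop : T ≠ ⊤ := by
    rw [hT]
    exact ENNReal.add_ne_top.2 ⟨ENNReal.add_ne_top.2 ⟨measure_ne_top _ _, measure_ne_top _ _⟩,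
      ENNReal.mul_ne_top hNtop hNtop⟩
  refine ⟨kernelConst d s p * (T.toReal + 1),
    mul_pos (kernelConst_pos d s p) (by positivity), fun g hg => ?_⟩
  have hF : Measurable fun v => ‖jap v ^ p * g v‖ₑ :=
    ((continuous_jap_rpow p).mul hg.continuous).measurable.enorm
  have hG : Measurable fun v => ‖jap v ^ (p - 1) * ‖fderiv ℝ g v‖‖ₑ :=
    ((continuous_jap_rpow (p - 1)).mul (hg.continuous_fderiv one_ne_zero).norm).measurable.enorm
  have hW : Measurable fun v : EuclideanSpace ℝ (Fin d) => ‖jap v ^ (-a)‖ₑ :=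
    (continuous_jap_rpow (-a)).measurable.enorm
  have bA := eLpNorm_lintegral_add_le volume (radialMeasure d s) hF
  have bB := eLpNorm_lintegral_add_le volume (contractedMeasure d s) hG
  have bR := eLpNorm_rank_one_le volume hW hF
  rw [eLpNorm_enorm (fun v => jap v ^ p * g v)] at bA bR
  rw [eLpNorm_enorm (fun v => jap v ^ (p - 1) * ‖fderiv ℝ g v‖)] at bB
  rw [hN] at bR
  have hsum := eLpNorm_two_le_of_enorm_le_mul_add (μ := volume)
    (hF.comp measurable_add).lintegral_prod_right' (hG.comp measurable_add).lintegral_prod_right'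
    (hW.mul_const _) ENNReal.ofReal_ne_top fun v =>
      (enorm_integral_le_lintegral_enorm (regularizedIntegrand s p g v)).trans
        (lintegral_enorm_regularizedIntegrand_le hs0 (le_trans (by positivity) ha.le) ha1 ha2 hg v)
  refine hsum.trans ?_
  rw [ENNReal.ofReal_mul (kernelConst_pos d s p).le, mul_assoc]
  gcongr
  generalize eLpNorm (fun v => jap v ^ p * g v) 2 volume = X at *
  generalize eLpNorm (fun v => jap v ^ (p - 1) * ‖fderiv ℝ g v‖) 2 volume = Y at *
  calc _ ≤ radialMeasure d s Set.univ * X + contractedMeasure d s Set.univ * Y + N * N * X :=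
        add_le_add (add_le_add bA bB) bR
    _ ≤ radialMeasure d s Set.univ * (X + Y) + contractedMeasure d s Set.univ * (X + Y) +
          N * N * (X + Y) := by
        gcongr
        exacts [le_self_add, le_add_self, le_self_add]
    _ = T * (X + Y) := by rw [hT, add_mul, add_mul]
    _ ≤ _ := by
        gcongr
        rw [← ENNReal.ofReal_toReal hTtop]
        exact ENNReal.ofReal_le_ofReal (by simp)

end Commutator

/-- Fix `d ≥ 1`, `s ∈ (0,1)` and `p ∈ (−2s, d/2 + 2s)`.  There is `C > 0` depending only
on `d, s, p` such that for every Schwartz `ḡ`, the principal value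
`L(v) = lim_{δ→0⁺} ∫_{|v−w|>δ} (⟨w⟩^p − ⟨v⟩^p) ḡ(w)/|v−w|^{d+2s} dw` exists for each `v`
and `‖L‖_{L²} ≤ C (‖⟨·⟩^p ḡ‖_{L²} + ‖⟨·⟩^{p−1} |∇ḡ|‖_{L²})`. -/
theorem stmt_11 (d : ℕ) (hd : 1 ≤ d) (s p : ℝ) (hs : s ∈ Set.Ioo (0 : ℝ) 1)
    (hp1 : -(2 * s) < p) (hp2 : p < d / 2 + 2 * s) :
    ∃ C : ℝ, 0 < C ∧
      ∀ g : SchwartzMap (EuclideanSpace ℝ (Fin d)) ℝ,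
        ∃ L : EuclideanSpace ℝ (Fin d) → ℝ,
          (∀ v : EuclideanSpace ℝ (Fin d),
            Filter.Tendsto
              (fun δ : ℝ =>
                ∫ w in {w : EuclideanSpace ℝ (Fin d) | δ < ‖v - w‖},
                  (jap w ^ p - jap v ^ p) * g w / ‖v - w‖ ^ ((d : ℝ) + 2 * s))
              (nhdsWithin 0 (Set.Ioi 0)) (nhds (L v))) ∧
          eLpNorm L 2 volume ≤
            ENNReal.ofReal C *
              (eLpNorm (fun v => jap v ^ p * g v) 2 volume +
               eLpNorm (fun v => jap v ^ (p - 1) * ‖fderiv ℝ (⇑g) v‖) 2 volume) := by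
  obtain ⟨hs0, hs1⟩ := hs
  have hd0 : (0 : ℝ) ≤ d := d.cast_nonneg
  have habs : |p| < d / 2 + 2 * s := abs_lt.2 ⟨by linarith, hp2⟩
  set a := min ((d : ℝ) / 2 + s) (d + 2 * s - |p|)
  have ha : (d : ℝ) / 2 < a := lt_min (by linarith) (by linarith)
  have ha1 : 2 * a ≤ d + 2 * s := by
    have : a ≤ (d : ℝ) / 2 + s := min_le_left _ _
    linarith
  have ha2 : |p| + a ≤ d + 2 * s := by
    have : a ≤ d + 2 * s - |p| := min_le_right _ _
    linarith
  obtain ⟨C, hC, hbound⟩ := exists_eLpNorm_regularizedIntegral_le hd hs0 hs1 ha ha1 ha2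
  refine ⟨C, hC, fun g => ⟨fun v => ∫ h, regularizedIntegrand s p g v h, fun v => ?_,
    hbound g (g.smooth 1)⟩⟩
  exact tendsto_truncated_integral hd p hs0 hs1
    (integrable_regularizedIntegrand hd hs0 hs1 (by linarith) ha1 ha2 g v)
end

section
/- Fix an integer d ≥ 1, s ∈ (0,1), ε > 0, and ξ ∈ ℝ^d, and let F : ℝ^d → ℂ be continuously differentiable. For t ≥ 0 and k ∈ ℝ^d define u(t,k) = F( εξ + e^{−ε^{−2s} t}(k − εξ) ) · exp( −∫_0^{ε^{−2s} t} |e^{−w}(k − εξ) + εξ|^{2s} dw ). Then u(0,k) = F(k) for all k, and at every point (t,k) with t > 0 such that e^{−w}(k − εξ) + εξ ≠ 0 for all w ∈ [0, ε^{−2s} t], the function u is differentiable in t and k and satisfies the transport equation ε^{2s} ∂_t u(t,k) − ε ξ·∇_k u(t,k) = − k·∇_k u(t,k) − |k|^{2s} u(t,k). -/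
open MeasureTheory

/-- The method-of-characteristics formula
`u(t,k) = F(εξ + e^{−ε^{−2s}t}(k − εξ)) · exp(−∫_0^{ε^{−2s}t} |e^{−w}(k − εξ) + εξ|^{2s} dw)`. -/
noncomputable def usol (d : ℕ) (s ε : ℝ) (ξ : EuclideanSpace ℝ (Fin d))
    (F : EuclideanSpace ℝ (Fin d) → ℂ) (t : ℝ) (k : EuclideanSpace ℝ (Fin d)) : ℂ :=
  F (ε • ξ + Real.exp (-(ε ^ (-(2 * s)) * t)) • (k - ε • ξ)) *
    Complex.exp (-((∫ w in (0 : ℝ)..(ε ^ (-(2 * s)) * t),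
        ‖Real.exp (-w) • (k - ε • ξ) + ε • ξ‖ ^ (2 * s) : ℝ) : ℂ))

/-- Differentiability of the integral of `φ` along the flow `w ↦ e^{−w}(k − c) + c` with respect to
the starting point `k`; the derivative in the direction of the flow is a boundary term. -/
theorem exists_hasFDerivAt_integral_comp_exp_smul {E : Type*} [NormedAddCommGroup E]
    [NormedSpace ℝ E] [ProperSpace E] {φ : E → ℝ} {U : Set E} (hφ : Continuous φ) (hU : IsOpen U)
    (hφU : ContDiffOn ℝ 1 φ U) {T : ℝ} (hT : 0 ≤ T) (c k : E)
    (h : ∀ w ∈ Set.Icc (0 : ℝ) T, Real.exp (-w) • (k - c) + c ∈ U) :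
    ∃ D : E →L[ℝ] ℝ,
      HasFDerivAt (fun κ => ∫ w in (0 : ℝ)..T, φ (Real.exp (-w) • (κ - c) + c)) D k ∧
      D (k - c) = φ k - φ (Real.exp (-T) • (k - c) + c) := by
  have hg : ∀ κ : E, Continuous fun w : ℝ => Real.exp (-w) • (κ - c) + c := fun κ => by fun_prop
  have hdφ : ContinuousOn (fderiv ℝ φ) U := hφU.continuousOn_fderiv_of_isOpen hU le_rfl
  have hdiff : ∀ x ∈ U, HasFDerivAt φ (fderiv ℝ φ x) x := fun x hx =>
    ((hφU.differentiableOn one_ne_zero).differentiableAt (hU.mem_nhds hx)).hasFDerivAt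
  have hK : IsCompact ((fun w : ℝ => Real.exp (-w) • (k - c) + c) '' Set.Icc 0 T) :=
    isCompact_Icc.image (hg k)
  obtain ⟨δ, hδ, hδU⟩ := hK.exists_cthickening_subset_open hU (Set.image_subset_iff.2 h)
  obtain ⟨C, hC⟩ := (hK.cthickening (r := δ)).exists_bound_of_continuousOn (hdφ.mono hδU)
  have hmem : ∀ w ∈ Set.Icc 0 T, ∀ κ ∈ Metric.ball k δ, Real.exp (-w) • (κ - c) + c ∈
      Metric.cthickening δ ((fun w : ℝ => Real.exp (-w) • (k - c) + c) '' Set.Icc 0 T) := by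
    intro w hw κ hκ
    refine Metric.mem_cthickening_of_dist_le _ _ _ _ (Set.mem_image_of_mem _ hw) ?_
    rw [dist_add_right, dist_smul₀, dist_sub_right, Real.norm_of_nonneg (Real.exp_pos _).le]
    have h1 : Real.exp (-w) ≤ 1 := Real.exp_le_one_iff.2 (by linarith [hw.1])
    exact (mul_le_of_le_one_left dist_nonneg h1).trans (Metric.mem_ball.1 hκ).le
  have hIoc : ∀ w ∈ Set.uIoc 0 T, w ∈ Set.Icc 0 T := fun w hw => by
    rw [Set.uIoc_of_le hT] at hw
    exact Set.Ioc_subset_Icc_self hw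
  have hcont : ContinuousOn (fun w : ℝ =>
      Real.exp (-w) • fderiv ℝ φ (Real.exp (-w) • (k - c) + c)) (Set.uIcc 0 T) := by
    rw [Set.uIcc_of_le hT]
    exact (by fun_prop : Continuous fun w : ℝ => Real.exp (-w)).continuousOn.smul
      (hdφ.comp (hg k).continuousOn h)
  have hint := hcont.intervalIntegrable (μ := volume)
  refine ⟨∫ w in (0 : ℝ)..T, Real.exp (-w) • fderiv ℝ φ (Real.exp (-w) • (k - c) + c), ?_, ?_⟩
  · refine intervalIntegral.hasFDerivAt_integral_of_dominated_of_fderiv_le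
      (F' := fun κ w => Real.exp (-w) • fderiv ℝ φ (Real.exp (-w) • (κ - c) + c))
      (bound := fun _ => C) (Metric.ball_mem_nhds k hδ) ?_ ?_ ?_ ?_ ?_ ?_
    · exact .of_forall fun κ => (hφ.comp (hg κ)).aestronglyMeasurable
    · exact (hφ.comp (hg k)).intervalIntegrable _ _
    · exact (intervalIntegrable_iff.1 hint).aestronglyMeasurable
    · refine .of_forall fun w hw κ hκ => ?_
      have h1 : Real.exp (-w) ≤ 1 := Real.exp_le_one_iff.2 (by linarith [(hIoc w hw).1])
      rw [norm_smul, Real.norm_of_nonneg (Real.exp_pos _).le]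
      exact (mul_le_of_le_one_left (norm_nonneg _) h1).trans (hC _ (hmem w (hIoc w hw) κ hκ))
    · exact intervalIntegrable_const
    · refine .of_forall fun w hw κ hκ => ?_
      have h1 : HasFDerivAt (fun κ : E => Real.exp (-w) • (κ - c) + c)
          (Real.exp (-w) • ContinuousLinearMap.id ℝ E) κ :=
        (((hasFDerivAt_id κ).sub_const c).const_smul _).add_const c
      refine ((hdiff _ (hδU (hmem w (hIoc w hw) κ hκ))).comp κ h1).congr_fderiv ?_
      ext v
      simp
  · rw [ContinuousLinearMap.intervalIntegral_apply hint]
    have hderiv : ∀ w ∈ Set.uIcc 0 T, HasDerivAt (fun w => -φ (Real.exp (-w) • (k - c) + c))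
        ((Real.exp (-w) • fderiv ℝ φ (Real.exp (-w) • (k - c) + c)) (k - c)) w := by
      intro w hw
      rw [Set.uIcc_of_le hT] at hw
      have h1 : HasDerivAt (fun w : ℝ => Real.exp (-w) • (k - c) + c)
          ((Real.exp (-w) * -1) • (k - c)) w :=
        (((hasDerivAt_id w).neg.exp).smul_const _).add_const c
      refine ((hdiff _ (h w hw)).comp_hasDerivAt w h1).neg.congr_deriv ?_
      simp
    rw [intervalIntegral.integral_eq_sub_of_hasDerivAt hderiv
      (hcont.clm_apply continuousOn_const).intervalIntegrable]
    simp
    ring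

/-- Fix `d ≥ 1`, `s ∈ (0,1)`, `ε > 0`, `ξ ∈ ℝ^d` and a `C¹` function `F : ℝ^d → ℂ`.
Then `u(0,k) = F(k)` for all `k`, and at every point `(t,k)` with `t > 0` such that
`e^{−w}(k − εξ) + εξ ≠ 0` for all `w ∈ [0, ε^{−2s} t]`, `u` is differentiable in `t` and
`k` and satisfies `ε^{2s} ∂_t u − ε ξ·∇_k u = −k·∇_k u − |k|^{2s} u`. -/
theorem stmt_19 (d : ℕ) (hd : 1 ≤ d) (s ε : ℝ) (hs : s ∈ Set.Ioo (0 : ℝ) 1) (hε : 0 < ε)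
    (ξ : EuclideanSpace ℝ (Fin d)) (F : EuclideanSpace ℝ (Fin d) → ℂ)
    (hF : ContDiff ℝ 1 F) :
    (∀ k : EuclideanSpace ℝ (Fin d), usol d s ε ξ F 0 k = F k) ∧
      ∀ t : ℝ, 0 < t → ∀ k : EuclideanSpace ℝ (Fin d),
        (∀ w ∈ Set.Icc (0 : ℝ) (ε ^ (-(2 * s)) * t),
          Real.exp (-w) • (k - ε • ξ) + ε • ξ ≠ 0) →
        ∃ ut : ℂ, ∃ Dk : EuclideanSpace ℝ (Fin d) →L[ℝ] ℂ,
          HasDerivAt (fun τ : ℝ => usol d s ε ξ F τ k) ut t ∧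
          HasFDerivAt (fun κ : EuclideanSpace ℝ (Fin d) => usol d s ε ξ F t κ) Dk k ∧
          (ε ^ (2 * s) : ℝ) • ut - ε • Dk ξ =
            -(Dk k) - (‖k‖ ^ (2 * s) : ℝ) • usol d s ε ξ F t k := by
  obtain ⟨hs0, -⟩ := hs
  refine ⟨fun k => by simp [usol], fun t ht k hk => ?_⟩
  set A : ℝ := ε ^ (-(2 * s)) with hA
  have hεA : ε ^ (2 * s) * A = 1 := by
    rw [hA, ← Real.rpow_add hε, add_neg_cancel, Real.rpow_zero]
  have hφ : Continuous fun x : EuclideanSpace ℝ (Fin d) => ‖x‖ ^ (2 * s) :=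
    continuous_norm.rpow_const fun _ => Or.inr (by positivity)
  obtain ⟨D, hD, hDk⟩ := exists_hasFDerivAt_integral_comp_exp_smul hφ
    isOpen_compl_singleton
    (fun x hx => ((contDiffAt_norm ℝ hx).rpow_const_of_ne (norm_ne_zero_iff.2 hx)).contDiffWithinAt)
    (T := A * t) (by positivity) (ε • ξ) k hk
  set c := ε • ξ with hc
  have hFd := (hF.differentiable one_ne_zero (c + Real.exp (-(A * t)) • (k - c))).hasFDerivAt
  set L := fderiv ℝ F (c + Real.exp (-(A * t)) • (k - c))
  have hlin : HasDerivAt (fun τ : ℝ => A * τ) A t := by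
    simpa using (hasDerivAt_id t).const_mul A
  have hFt : HasDerivAt (fun τ : ℝ => F (c + Real.exp (-(A * τ)) • (k - c)))
      (L ((Real.exp (-(A * t)) * -A) • (k - c))) t :=
    hFd.comp_hasDerivAt t ((hlin.neg.exp.smul_const (k - c)).const_add c)
  have hIt : HasDerivAt (fun τ : ℝ => ∫ w in (0 : ℝ)..(A * τ),
      ‖Real.exp (-w) • (k - c) + c‖ ^ (2 * s))
      (‖Real.exp (-(A * t)) • (k - c) + c‖ ^ (2 * s) * A) t :=
    ((hφ.comp (by fun_prop : Continuous fun w : ℝ =>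
      Real.exp (-w) • (k - c) + c)).integral_hasStrictDerivAt 0 (A * t)).hasDerivAt.comp t hlin
  have hFk : HasFDerivAt (fun κ => F (c + Real.exp (-(A * t)) • (κ - c)))
      (L.comp (Real.exp (-(A * t)) • ContinuousLinearMap.id ℝ (EuclideanSpace ℝ (Fin d)))) k :=
    hFd.comp k
      ((((hasFDerivAt_id k).sub_const c).const_smul (Real.exp (-(A * t)))).const_add c)
  refine ⟨_, _, hFt.mul hIt.ofReal_comp.neg.cexp,
    hFk.mul (Complex.ofRealCLM.hasFDerivAt.comp k hD).neg.cexp, ?_⟩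
  have hE : (D k : ℂ) - D c =
      (‖k‖ ^ (2 * s) : ℝ) - (‖Real.exp (-(A * t)) • (k - c) + c‖ ^ (2 * s) : ℝ) := by
    rw [← Complex.ofReal_sub, ← map_sub, hDk, Complex.ofReal_sub]
  have hDc : (D c : ℂ) = ε * D ξ := by simp [hc]
  have hLc : L c = ε * L ξ := by simp [hc]
  have hεA' : ((ε ^ (2 * s) : ℝ) : ℂ) * A = 1 := by exact_mod_cast hεA
  simp only [usol, ← hA, ← hc]
  set n := ‖Real.exp (-(A * t)) • (k - c) + c‖ ^ (2 * s)
  set e := Complex.exp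
    (-((∫ w in (0 : ℝ)..(A * t), ‖Real.exp (-w) • (k - c) + c‖ ^ (2 * s) : ℝ) : ℂ))
  set f := F (c + Real.exp (-(A * t)) • (k - c))
  set κ := ‖k‖ ^ (2 * s)
  set x := Real.exp (-(A * t))
  set a := ε ^ (2 * s)
  simp [-Complex.ofReal_exp]
  linear_combination (-(x * (L k - L c) * e) - f * e * n) * hεA' - f * e * hE - f * e * hDc +
    x * e * hLc
end
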